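/- arXiv:2302.05497 — 3 statements merged into one kernel-verified Lean document; each statement's English description precedes it below -/
import Mathlib

section
/- For a nonempty A ⊆ V the following are equivalent: (a) for every u ∈ ∂_AΣ, every continuous path ζ : [0,∞) → Σ with ζ_0 = u satisfying conditions (A) and (B) is constant, i.e. ζ_t = u for all t ≥ 0; (b) A is r-absorbing and λ^A(i) = 0 for every i ∈ A; (c) A ⊆ ℳ, where ℳ = {i ∈ V : μ(i) = max_{k∈V} μ(k)}. -/
open Finset

section ZRP

variable {V : Type*} [Fintype V] [DecidableEq V]

/-- Irreducibility of a set of transition rates. -/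
def IrreducibleRates (r : V → V → ℝ) : Prop :=
  ∀ i j : V, i ≠ j → ∃ (m : ℕ) (k : ℕ → V), k 0 = i ∧ k m = j ∧ ∀ l < m, 0 < r (k l) (k (l + 1))

/-- `ind A j` plays the role of the vector `1^A_j`: it equals the indicator of `{j}` on `A`
and is harmonic (for the generator of `r`) at every point outside `A`. -/
def IsHarmFamily (r : V → V → ℝ) (ind : Finset V → V → V → ℝ) : Prop :=
  ∀ (A : Finset V), ∀ j ∈ A,
    (∀ i ∈ A, ind A j i = if i = j then (1 : ℝ) else 0) ∧
    (∀ k, k ∉ A → ∑ l, r k l * (ind A j l - ind A j k) = 0)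

/-- The trace rates `r^A(i,j) = r(i,j) + ∑_{k∉A} r(i,k)·1^A_j(k)` (for `i ≠ j`). -/
noncomputable def traceRate (r : V → V → ℝ) (ind : Finset V → V → V → ℝ)
    (A : Finset V) (i j : V) : ℝ :=
  if i = j then 0 else r i j + ∑ k ∈ Aᶜ, r i k * ind A j k

/-- `λ^A(i) = ∑_{j∈A} (r^A(j,i) − r^A(i,j))`. -/
noncomputable def lamA (r : V → V → ℝ) (ind : Finset V → V → V → ℝ)
    (A : Finset V) (i : V) : ℝ :=
  ∑ j ∈ A, (traceRate r ind A j i - traceRate r ind A i j)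

/-- `A` is `r`-absorbing if `A = V` or `λ^{A∪{j}}(j) ≤ 0` for every `j ∉ A`. -/
def IsAbsorbing (r : V → V → ℝ) (ind : Finset V → V → V → ℝ) (A : Finset V) : Prop :=
  A = Finset.univ ∨ ∀ j ∉ A, lamA r ind (insert j A) j ≤ 0

/-- The support `𝒮(u) = {i : u i > 0}`. -/
noncomputable def suppF (u : V → ℝ) : Finset V :=
  open scoped Classical in Finset.univ.filter (fun i => 0 < u i)

/-- `𝒜(S)`: the intersection of all `r`-absorbing subsets of `V` containing `S`. -/
noncomputable def minAbs (r : V → V → ℝ) (ind : Finset V → V → V → ℝ) (S : Finset V) :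
    Finset V :=
  open scoped Classical in
  Finset.univ.filter (fun i => ∀ A : Finset V, IsAbsorbing r ind A → S ⊆ A → i ∈ A)

/-- The vector `v_i = ∑_k r(i,k)(1_{k} − 1_{i})`. -/
noncomputable def vvec (r : V → V → ℝ) (i : V) : V → ℝ :=
  fun l => ∑ k, r i k * ((if l = k then (1 : ℝ) else 0) - (if l = i then (1 : ℝ) else 0))

/-- The vector `λ(j) = ∑_i (r(i,j) − r(j,i))`. -/
noncomputable def lamV (r : V → V → ℝ) : V → ℝ := fun j => ∑ i, (r i j - r j i)

/-- Membership in `D_B`: `f` is `C¹` on an open set containing the simplex and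
`⟨∇f(u), v_i⟩ = 0` whenever `u ∈ Σ`, `u i = 0`, for every `i ∈ B`. -/
def MemD (r : V → V → ℝ) (B : Finset V) (f : (V → ℝ) → ℝ) : Prop :=
  (∃ U : Set (V → ℝ), IsOpen U ∧ stdSimplex ℝ V ⊆ U ∧ ContDiffOn ℝ 1 f U) ∧
  ∀ i ∈ B, ∀ u ∈ stdSimplex ℝ V, u i = 0 → fderiv ℝ f u (vvec r i) = 0

/-- Condition (A). -/
def CondA (r : V → V → ℝ) (ζ : ℝ → V → ℝ) : Prop :=
  ∀ f : (V → ℝ) → ℝ, MemD r Finset.univ f → ∀ t : ℝ, 0 ≤ t →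
    f (ζ t) = f (ζ 0) + ∫ s in (0:ℝ)..t, fderiv ℝ f (ζ s) (lamV r)

/-- A continuous path in the simplex (for nonnegative times). -/
def IsPath (ζ : ℝ → V → ℝ) : Prop :=
  ContinuousOn ζ (Set.Ici 0) ∧ ∀ t : ℝ, 0 ≤ t → ζ t ∈ stdSimplex ℝ V

/-- `Σ_abs`: the configurations whose support is `r`-absorbing. -/
def SigmaAbs (r : V → V → ℝ) (ind : Finset V → V → V → ℝ) : Set (V → ℝ) :=
  {u | u ∈ stdSimplex ℝ V ∧ IsAbsorbing r ind (suppF u)}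

/-- Condition (B): `inf{t ≥ 0 : ζ_t ∈ Σ_abs} = 0`. -/
def CondB (r : V → V → ℝ) (ind : Finset V → V → V → ℝ) (ζ : ℝ → V → ℝ) : Prop :=
  ∀ ε : ℝ, 0 < ε → ∃ t : ℝ, 0 ≤ t ∧ t < ε ∧ ζ t ∈ SigmaAbs r ind

end ZRP

section Generator

variable {V : Type*} [Fintype V] [DecidableEq V]

/-- The generator `Lw(i) = ∑_k r(i,k)(w(k) − w(i))`. -/
def gen (r : V → V → ℝ) (w : V → ℝ) (i : V) : ℝ :=
  ∑ k, r i k * (w k - w i)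

/-- The net flow into `k` when each site `i` is left at rate `p i * r i ·`; this is the adjoint
of the generator applied to `p`. -/
def flow (r : V → V → ℝ) (p : V → ℝ) (k : V) : ℝ :=
  ∑ i, (p i * r i k - p k * r k i)

/-- The rates of the time reversal with respect to `μ`. -/
noncomputable def revRates (r : V → V → ℝ) (μ : V → ℝ) (i j : V) : ℝ :=
  μ j * r j i / μ i

omit [DecidableEq V] in
lemma gen_sub (r : V → V → ℝ) (w w' : V → ℝ) (i : V) :
    gen r (w - w') i = gen r w i - gen r w' i := by
  simp only [gen, ← sum_sub_distrib, Pi.sub_apply]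
  exact sum_congr rfl fun _ _ => by ring

omit [DecidableEq V] in
lemma gen_smul (r : V → V → ℝ) (a : ℝ) (w : V → ℝ) (i : V) :
    gen r (a • w) i = a * gen r w i := by
  simp only [gen, mul_sum, Pi.smul_apply, smul_eq_mul]
  exact sum_congr rfl fun _ _ => by ring

omit [DecidableEq V] in
lemma gen_add (r : V → V → ℝ) (w w' : V → ℝ) (i : V) :
    gen r (w + w') i = gen r w i + gen r w' i := by
  simp only [gen, ← sum_add_distrib, Pi.add_apply]
  exact sum_congr rfl fun _ _ => by ring

omit [DecidableEq V] in
lemma flow_sub (r : V → V → ℝ) (p p' : V → ℝ) (i : V) :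
    flow r (p - p') i = flow r p i - flow r p' i := by
  simp only [flow, ← sum_sub_distrib, Pi.sub_apply]
  exact sum_congr rfl fun _ _ => by ring

omit [DecidableEq V] in
lemma sum_mul_gen (r : V → V → ℝ) (p w : V → ℝ) :
    ∑ i, p i * gen r w i = ∑ k, w k * flow r p k := by
  have h1 : ∑ i, p i * gen r w i
      = ∑ i, ∑ k, p i * r i k * w k - ∑ i, ∑ k, p i * r i k * w i := by
    rw [← sum_sub_distrib]
    refine sum_congr rfl fun i _ => ?_
    rw [gen, mul_sum, ← sum_sub_distrib]
    exact sum_congr rfl fun _ _ => by ring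
  have h2 : ∑ k, w k * flow r p k
      = ∑ k, ∑ i, p i * r i k * w k - ∑ k, ∑ i, p k * r k i * w k := by
    rw [← sum_sub_distrib]
    refine sum_congr rfl fun i _ => ?_
    rw [flow, mul_sum, ← sum_sub_distrib]
    exact sum_congr rfl fun _ _ => by ring
  rw [h1, h2, sum_comm]

omit [DecidableEq V] in
lemma sum_flow (r : V → V → ℝ) (p : V → ℝ) : ∑ k, flow r p k = 0 := by
  have h := sum_mul_gen r p (fun _ => 1)
  simp only [one_mul] at h
  rw [← h]
  simp [gen]

lemma sum_mul_vvec (r : V → V → ℝ) (g : V → ℝ) (i : V) :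
    ∑ l, g l * vvec r i l = gen r g i := by
  simp only [vvec, gen, mul_sum]
  rw [sum_comm]
  refine sum_congr rfl fun k _ => ?_
  have : ∀ l, g l * (r i k * ((if l = k then (1 : ℝ) else 0) - (if l = i then (1 : ℝ) else 0)))
      = r i k * ((if l = k then g l else 0) - (if l = i then g l else 0)) := by
    intro l
    split_ifs <;> ring
  simp [this, ← mul_sum, sum_sub_distrib]

lemma sum_smul_vvec (r : V → V → ℝ) (p : V → ℝ) : ∑ i, p i • vvec r i = flow r p := by
  ext k
  have h := sum_mul_gen r p (Pi.single k 1)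
  simp only [← sum_mul_vvec] at h
  simpa [Pi.single_apply] using h

omit [DecidableEq V] in
lemma lamV_eq_flow_one (r : V → V → ℝ) : lamV r = flow r 1 := by
  ext k
  simp [lamV, flow]

omit [DecidableEq V] in
/-- Minimum principle. -/
lemma nonneg_of_gen_nonpos {r : V → V → ℝ} (hr : ∀ i j, 0 ≤ r i j) (hirr : IrreducibleRates r)
    {S : Finset V} (hS : S.Nonempty) {g : V → ℝ} (hg : ∀ i ∈ S, 0 ≤ g i)
    (hL : ∀ i ∉ S, gen r g i ≤ 0) (i : V) : 0 ≤ g i := by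
  obtain ⟨s, hs⟩ := hS
  have : Nonempty V := ⟨s⟩
  obtain ⟨a, ha⟩ := Finite.exists_min g
  refine le_trans ?_ (ha i)
  by_contra! hneg
  have hne : a ≠ s := by
    rintro rfl
    exact absurd (hg a hs) (not_le.2 hneg)
  obtain ⟨m, k, hk0, hkm, hk⟩ := hirr a s hne
  have key : ∀ l, l ≤ m → g (k l) = g a := by
    intro l
    induction l with
    | zero => intro _; rw [hk0]
    | succ l ih =>
      intro hl
      have hl' := ih (by omega)
      have hnS : k l ∉ S := fun h => absurd (hg _ h) (by rw [hl']; exact not_le.2 hneg)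
      have hterm : ∀ j ∈ univ, 0 ≤ r (k l) j * (g j - g (k l)) := fun j _ =>
        mul_nonneg (hr _ _) (by rw [hl']; linarith [ha j])
      have hz := (sum_eq_zero_iff_of_nonneg hterm).1
        (le_antisymm (hL _ hnS) (sum_nonneg hterm)) (k (l + 1)) (mem_univ _)
      rcases mul_eq_zero.1 hz with h | h
      · exact absurd h (hk l (by omega)).ne'
      · linarith
  have := key m le_rfl
  rw [hkm] at this
  linarith [hg s hs]

omit [DecidableEq V] in
lemma eq_of_gen_eq {r : V → V → ℝ} (hr : ∀ i j, 0 ≤ r i j) (hirr : IrreducibleRates r)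
    {S : Finset V} (hS : S.Nonempty) {g g' : V → ℝ} (hg : ∀ i ∈ S, g i = g' i)
    (hL : ∀ i ∉ S, gen r g i = gen r g' i) : g = g' := by
  ext i
  have h1 := nonneg_of_gen_nonpos hr hirr hS (g := g - g') (fun i hi => by simp [hg i hi])
    (fun i hi => by rw [gen_sub, hL i hi, sub_self]) i
  have h2 := nonneg_of_gen_nonpos hr hirr hS (g := g' - g) (fun i hi => by simp [hg i hi])
    (fun i hi => by rw [gen_sub, hL i hi, sub_self]) i
  simp only [Pi.sub_apply] at h1 h2
  linarith

/-- Solvability of the Dirichlet problem. -/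
lemma exists_dirichlet {r : V → V → ℝ} (hr : ∀ i j, 0 ≤ r i j) (hirr : IrreducibleRates r)
    {S : Finset V} (hS : S.Nonempty) (b : V → ℝ) :
    ∃ g : V → ℝ, (∀ i ∈ S, g i = b i) ∧ ∀ i ∉ S, gen r g i = b i := by
  let φ : (V → ℝ) →ₗ[ℝ] (V → ℝ) :=
    { toFun := fun g i => if i ∈ S then g i else gen r g i
      map_add' := fun g g' => by
        ext i
        by_cases h : i ∈ S <;> simp [h, gen_add]
      map_smul' := fun a g => by
        ext i
        by_cases h : i ∈ S <;> simp [h, gen_smul] }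
  have hφ : ∀ g i, φ g i = if i ∈ S then g i else gen r g i := fun _ _ => rfl
  have hinj : Function.Injective φ := by
    intro g g' h
    refine eq_of_gen_eq hr hirr hS (fun i hi => ?_) (fun i hi => ?_)
    · simpa [hφ, hi] using congrFun h i
    · simpa [hφ, hi] using congrFun h i
  obtain ⟨g, hg⟩ := LinearMap.injective_iff_surjective.1 hinj b
  refine ⟨g, fun i hi => ?_, fun i hi => ?_⟩
  · simpa [hφ, hi] using congrFun hg i
  · simpa [hφ, hi] using congrFun hg i

omit [DecidableEq V] in
lemma gen_revRates {r : V → V → ℝ} {μ : V → ℝ} (hμ_pos : ∀ i, 0 < μ i) (hμ : flow r μ = 0)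
    (p : V → ℝ) (k : V) : μ k * gen (revRates r μ) (p / μ) k = flow r p k := by
  have h0 : ∑ i, (μ i * r i k - μ k * r k i) = 0 := congrFun hμ k
  have hk := (hμ_pos k).ne'
  have : flow r p k = μ k * gen (revRates r μ) (p / μ) k
      + p k / μ k * ∑ i, (μ i * r i k - μ k * r k i) := by
    simp only [flow, gen, revRates, mul_sum, ← sum_add_distrib, Pi.div_apply]
    refine sum_congr rfl fun i _ => ?_
    have hi := (hμ_pos i).ne'
    field_simp
    ring
  rw [this, h0]
  ring

omit [Fintype V] [DecidableEq V] in
lemma revRates_nonneg {r : V → V → ℝ} (hr : ∀ i j, 0 ≤ r i j) {μ : V → ℝ}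
    (hμ_pos : ∀ i, 0 < μ i) (i j : V) : 0 ≤ revRates r μ i j :=
  div_nonneg (mul_nonneg (hμ_pos j).le (hr j i)) (hμ_pos i).le

omit [Fintype V] [DecidableEq V] in
lemma IrreducibleRates.revRates {r : V → V → ℝ} (hirr : IrreducibleRates r) {μ : V → ℝ}
    (hμ_pos : ∀ i, 0 < μ i) : IrreducibleRates (revRates r μ) := by
  intro i j hij
  obtain ⟨m, k, h0, hm, hk⟩ := hirr j i hij.symm
  refine ⟨m, fun l => k (m - l), by simpa using hm, by simpa using h0, fun l hl => ?_⟩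
  have := hk (m - (l + 1)) (by omega)
  rw [show m - (l + 1) + 1 = m - l by omega] at this
  exact div_pos (mul_pos (hμ_pos _) this) (hμ_pos _)

omit [DecidableEq V] in
lemma nonneg_of_flow_nonpos {r : V → V → ℝ} (hr : ∀ i j, 0 ≤ r i j) (hirr : IrreducibleRates r)
    {μ : V → ℝ} (hμ_pos : ∀ i, 0 < μ i) (hμ : flow r μ = 0)
    {S : Finset V} (hS : S.Nonempty) {p : V → ℝ} (hp : ∀ i ∈ S, 0 ≤ p i)
    (hL : ∀ i ∉ S, flow r p i ≤ 0) (i : V) : 0 ≤ p i := by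
  have h := nonneg_of_gen_nonpos (revRates_nonneg hr hμ_pos) (hirr.revRates hμ_pos) hS
    (g := p / μ) (fun i hi => div_nonneg (hp i hi) (hμ_pos i).le)
    (fun i hi => by
      have h1 := hL i hi
      rw [← gen_revRates hμ_pos hμ] at h1
      exact nonpos_of_mul_nonpos_right h1 (hμ_pos i)) i
  have h2 := mul_nonneg h (hμ_pos i).le
  rwa [Pi.div_apply, div_mul_cancel₀ _ (hμ_pos i).ne'] at h2

lemma exists_flow_eq_zero {r : V → V → ℝ} (hr : ∀ i j, 0 ≤ r i j) (hirr : IrreducibleRates r)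
    {μ : V → ℝ} (hμ_pos : ∀ i, 0 < μ i) (hμ : flow r μ = 0) {S : Finset V} (hS : S.Nonempty) :
    ∃ p : V → ℝ, (∀ i ∈ S, p i = 1) ∧ ∀ i ∉ S, flow r p i = 0 := by
  obtain ⟨q, hq1, hq2⟩ := exists_dirichlet (revRates_nonneg hr hμ_pos) (hirr.revRates hμ_pos) hS
    (fun i => if i ∈ S then 1 / μ i else 0)
  have hdiv : (q * μ) / μ = q := by
    ext i
    simp [(hμ_pos i).ne']
  refine ⟨q * μ, fun i hi => ?_, fun i hi => ?_⟩
  · simp [hq1 i hi, hi, (hμ_pos i).ne']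
  · rw [← gen_revRates hμ_pos hμ, hdiv, hq2 i hi]
    simp [hi]

end Generator

section Trace

variable {V : Type*} [Fintype V] [DecidableEq V]

omit [DecidableEq V] in
lemma gen_sum_mul (r : V → V → ℝ) (B : Finset V) (a : V → ℝ) (h : V → V → ℝ) (i : V) :
    gen r (fun k => ∑ j ∈ B, a j * h j k) i = ∑ j ∈ B, a j * gen r (h j) i := by
  simp only [gen, mul_sum, ← sum_sub_distrib]
  rw [sum_comm]
  exact sum_congr rfl fun _ _ => sum_congr rfl fun _ _ => by ring

lemma eq_sum_ind {r : V → V → ℝ} (hr : ∀ i j, 0 ≤ r i j) (hirr : IrreducibleRates r)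
    {ind : Finset V → V → V → ℝ} (hind : IsHarmFamily r ind) {B : Finset V} (hB : B.Nonempty)
    {g : V → ℝ} (hg : ∀ k ∉ B, gen r g k = 0) (k : V) : g k = ∑ j ∈ B, g j * ind B j k := by
  refine congrFun (eq_of_gen_eq hr hirr hB (g := g) (g' := fun k => ∑ j ∈ B, g j * ind B j k)
    (fun i hi => ?_) (fun i hi => ?_)) k
  · rw [sum_congr rfl fun j hj => by rw [(hind B j hj).1 i hi]]
    simp [hi]
  · rw [hg i hi, gen_sum_mul, eq_comm]
    exact sum_eq_zero fun j hj => by rw [show gen r (ind B j) i = 0 from (hind B j hj).2 i hi,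
      mul_zero]

lemma sum_ind {r : V → V → ℝ} (hr : ∀ i j, 0 ≤ r i j) (hirr : IrreducibleRates r)
    {ind : Finset V → V → V → ℝ} (hind : IsHarmFamily r ind) {B : Finset V} (hB : B.Nonempty)
    (k : V) : ∑ j ∈ B, ind B j k = 1 := by
  have := eq_sum_ind hr hirr hind hB (g := fun _ => 1) (fun k _ => by simp [gen]) k
  simpa using this.symm

lemma ind_le_one {r : V → V → ℝ} (hr : ∀ i j, 0 ≤ r i j) (hirr : IrreducibleRates r)
    {ind : Finset V → V → V → ℝ} (hind : IsHarmFamily r ind) {B : Finset V} {j : V} (hj : j ∈ B)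
    (k : V) : ind B j k ≤ 1 := by
  have h := nonneg_of_gen_nonpos hr hirr ⟨j, hj⟩ (g := (fun _ => 1) - ind B j)
    (fun i hi => by
      simp only [Pi.sub_apply, (hind B j hj).1 i hi]
      split_ifs <;> norm_num)
    (fun i hi => by
      rw [gen_sub, show gen r (ind B j) i = 0 from (hind B j hj).2 i hi]
      simp [gen]) k
  simp only [Pi.sub_apply] at h
  linarith

lemma lamA_eq_sum_gen {r : V → V → ℝ} (hr : ∀ i j, 0 ≤ r i j) (hdiag : ∀ i, r i i = 0)
    (hirr : IrreducibleRates r) {ind : Finset V → V → V → ℝ} (hind : IsHarmFamily r ind)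
    {B : Finset V} {j : V} (hj : j ∈ B) :
    lamA r ind B j = ∑ i ∈ B, gen r (ind B j) i := by
  have hgen : ∀ i ∈ B, gen r (ind B j) i
      = r i j + ∑ k ∈ Bᶜ, r i k * ind B j k - (if i = j then ∑ k, r i k else 0) := by
    intro i hi
    have h1 : gen r (ind B j) i = ∑ k, r i k * ind B j k - (∑ k, r i k) * ind B j i := by
      simp only [gen, sum_mul, ← sum_sub_distrib]
      exact sum_congr rfl fun _ _ => by ring
    have h2 : ∑ k ∈ B, r i k * ind B j k = r i j := by
      rw [sum_congr rfl fun k hk => by rw [(hind B j hj).1 k hk]]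
      simp [hj]
    rw [h1, ← sum_add_sum_compl B, h2, (hind B j hj).1 i hi]
    split_ifs <;> simp
  have htr : ∀ i, traceRate r ind B i j
      = (r i j + ∑ k ∈ Bᶜ, r i k * ind B j k)
        - (if i = j then ∑ k ∈ Bᶜ, r j k * ind B j k else 0) := by
    intro i
    unfold traceRate
    split_ifs with h
    · subst h
      simp [hdiag]
    · simp
  have hout : ∑ i ∈ B, traceRate r ind B j i
      = ∑ k, r j k - ∑ k ∈ Bᶜ, r j k * ind B j k := by
    have h1 : ∀ i ∈ B, traceRate r ind B j i = (r j i + ∑ k ∈ Bᶜ, r j k * ind B i k)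
        - (if i = j then ∑ k ∈ Bᶜ, r j k * ind B j k else 0) := by
      intro i _
      unfold traceRate
      split_ifs with h h' h'
      · subst h
        simp [hdiag]
      · exact absurd h.symm h'
      · exact absurd h'.symm h
      · simp
    rw [sum_congr rfl h1, sum_sub_distrib, sum_add_distrib, sum_comm]
    have h2 : ∑ k ∈ Bᶜ, ∑ i ∈ B, r j k * ind B i k = ∑ k ∈ Bᶜ, r j k :=
      sum_congr rfl fun k _ => by
        rw [← mul_sum, sum_ind hr hirr hind ⟨j, hj⟩, mul_one]
    rw [h2, sum_add_sum_compl]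
    simp [hj]
  rw [lamA, sum_sub_distrib, hout, sum_congr rfl fun i _ => htr i, sum_congr rfl hgen]
  simp only [sum_sub_distrib, sum_ite_eq', hj, if_true]
  ring

/-- The function `1^{B ∪ {j}}_j` has negative generator at `j ∉ B`, for `B` nonempty. -/
lemma gen_ind_insert_neg {r : V → V → ℝ} (hr : ∀ i j, 0 ≤ r i j) (hirr : IrreducibleRates r)
    {ind : Finset V → V → V → ℝ} (hind : IsHarmFamily r ind) {B : Finset V} (hB : B.Nonempty)
    {j : V} (hj : j ∉ B) : gen r (ind (insert j B) j) j < 0 := by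
  have hjm := mem_insert_self j B
  have hjj : ind (insert j B) j j = 1 := by simp [(hind _ j hjm).1 j hjm]
  refine lt_of_le_of_ne ?_ fun h0 => ?_
  · refine sum_nonpos fun k _ => mul_nonpos_of_nonneg_of_nonpos (hr _ _) ?_
    rw [hjj]
    linarith [ind_le_one hr hirr hind hjm k]
  · have := congrFun (eq_of_gen_eq hr hirr hB (g := ind (insert j B) j) (g' := 0)
      (fun i hi => by
        rw [(hind _ j hjm).1 i (mem_insert_of_mem hi), if_neg]
        · rfl
        · rintro rfl
          exact hj hi)
      (fun i hi => by
        have hz : gen r (0 : V → ℝ) i = 0 := by simp [gen]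
        rw [hz]
        by_cases hij : i = j
        · rw [hij, h0]
        · exact (hind _ j hjm).2 i (by simp [hij, hi]))) j
    rw [hjj] at this
    simp at this

/-- `p` records the effective exit intensities of the sites when exactly those of `B` are
saturated. -/
def IsEquilibrium (r : V → V → ℝ) (B : Finset V) (p : V → ℝ) : Prop :=
  (∀ i ∈ B, p i = 1) ∧ (∀ k ∉ B, flow r p k = 0) ∧ ∀ k, p k ≤ 1

lemma sum_gen_ind_insert {r : V → V → ℝ} {ind : Finset V → V → V → ℝ}
    (hind : IsHarmFamily r ind) {B : Finset V} {p : V → ℝ} (hp1 : ∀ i ∈ B, p i = 1)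
    (hp2 : ∀ k ∉ B, flow r p k = 0) {j : V} (hj : j ∉ B) :
    ∑ i ∈ insert j B, gen r (ind (insert j B) j) i
      = (1 - p j) * gen r (ind (insert j B) j) j := by
  have hjm := mem_insert_self j B
  set h := ind (insert j B) j with hh
  have h1 : ∑ i, p i * gen r h i = 0 := by
    rw [sum_mul_gen]
    refine sum_eq_zero fun k _ => ?_
    by_cases hk : k ∈ B
    · rw [hh, (hind _ j hjm).1 k (mem_insert_of_mem hk), if_neg, zero_mul]
      rintro rfl
      exact hj hk
    · rw [hp2 k hk, mul_zero]
  have h2 : ∑ i, p i * gen r h i = ∑ i ∈ insert j B, p i * gen r h i := by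
    refine (sum_subset (subset_univ _) fun i _ hi => ?_).symm
    rw [show gen r h i = 0 from (hind _ j hjm).2 i hi, mul_zero]
  rw [h2, sum_insert hj, sum_congr rfl fun i hi => by rw [hp1 i hi, one_mul]] at h1
  rw [sum_insert hj]
  linarith

lemma isAbsorbing_iff {r : V → V → ℝ} (hr : ∀ i j, 0 ≤ r i j) (hdiag : ∀ i, r i i = 0)
    (hirr : IrreducibleRates r) {ind : Finset V → V → V → ℝ} (hind : IsHarmFamily r ind)
    {μ : V → ℝ} (hμ_pos : ∀ i, 0 < μ i) (hμ : flow r μ = 0) {B : Finset V} (hB : B.Nonempty) :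
    IsAbsorbing r ind B ↔ ∃ p, IsEquilibrium r B p := by
  constructor
  · intro h
    obtain ⟨p, hp1, hp2⟩ := exists_flow_eq_zero hr hirr hμ_pos hμ hB
    refine ⟨p, hp1, hp2, fun k => ?_⟩
    by_cases hk : k ∈ B
    · exact (hp1 k hk).le
    rcases h with rfl | h
    · exact absurd (mem_univ k) hk
    have h1 := h k hk
    rw [lamA_eq_sum_gen hr hdiag hirr hind (mem_insert_self k B),
      sum_gen_ind_insert hind hp1 hp2 hk] at h1
    have h2 := gen_ind_insert_neg hr hirr hind hB hk
    nlinarith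
  · rintro ⟨p, hp1, hp2, hp3⟩
    refine Or.inr fun j hj => ?_
    rw [lamA_eq_sum_gen hr hdiag hirr hind (mem_insert_self j B),
      sum_gen_ind_insert hind hp1 hp2 hj]
    exact mul_nonpos_of_nonneg_of_nonpos (by linarith [hp3 j])
      (gen_ind_insert_neg hr hirr hind hB hj).le

/-- Sites of an absorbing set with nonpositive drift may be removed from it. -/
lemma IsEquilibrium.exists_subset {r : V → V → ℝ} (hr : ∀ i j, 0 ≤ r i j)
    (hirr : IrreducibleRates r) {μ : V → ℝ} (hμ_pos : ∀ i, 0 < μ i) (hμ : flow r μ = 0)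
    {B B' : Finset V} {p : V → ℝ} (hp : IsEquilibrium r B p) (hB' : B'.Nonempty) (hsub : B' ⊆ B)
    (hneg : ∀ k ∈ B, k ∉ B' → flow r p k ≤ 0) : ∃ p', IsEquilibrium r B' p' := by
  obtain ⟨p', hp1, hp2⟩ := exists_flow_eq_zero hr hirr hμ_pos hμ hB'
  refine ⟨p', hp1, hp2, fun k => ?_⟩
  have h := nonneg_of_flow_nonpos hr hirr hμ_pos hμ hB' (p := p - p')
    (fun i hi => by simp [hp1 i hi, hp.1 i (hsub hi)])
    (fun i hi => by
      rw [flow_sub, hp2 i hi, sub_zero]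
      by_cases hiB : i ∈ B
      · exact hneg i hiB hi
      · exact (hp.2.1 i hiB).le) k
  simp only [Pi.sub_apply] at h
  linarith [hp.2.2 k]

lemma absorbing_and_lamA_eq_zero_iff {r : V → V → ℝ} (hr : ∀ i j, 0 ≤ r i j)
    (hdiag : ∀ i, r i i = 0) (hirr : IrreducibleRates r) {ind : Finset V → V → V → ℝ}
    (hind : IsHarmFamily r ind) {μ : V → ℝ} (hμ_pos : ∀ i, 0 < μ i) (hμ : flow r μ = 0)
    {A : Finset V} (hA : A.Nonempty) :
    (IsAbsorbing r ind A ∧ ∀ i ∈ A, lamA r ind A i = 0) ↔ ∀ i ∈ A, ∀ k, μ k ≤ μ i := by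
  have hsum : ∀ j ∈ A, ∑ i ∈ A, μ i * gen r (ind A j) i = 0 := by
    intro j hj
    have h1 : ∑ i, μ i * gen r (ind A j) i = 0 := by
      rw [sum_mul_gen, hμ]
      simp
    rw [← h1]
    refine sum_subset (subset_univ _) fun i _ hi => ?_
    rw [show gen r (ind A j) i = 0 from (hind _ j hj).2 i hi, mul_zero]
  have hequil : ∀ m : ℝ, 0 < m → (∀ i ∈ A, μ i = m) →
      (∀ i ∈ A, (m⁻¹ • μ) i = 1) ∧ ∀ k, flow r (m⁻¹ • μ) k = 0 := by
    intro m hm h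
    refine ⟨fun i hi => by simp [h i hi, hm.ne'], fun k => ?_⟩
    have h1 : flow r (m⁻¹ • μ) k = m⁻¹ * flow r μ k := by
      simp only [flow, mul_sum, Pi.smul_apply, smul_eq_mul]
      exact sum_congr rfl fun _ _ => by ring
    rw [h1, hμ]
    simp
  constructor
  · rintro ⟨habs, hlam⟩
    obtain ⟨a, haA, ha⟩ := exists_max_image A μ hA
    have hconst : ∀ i ∈ A, μ i = μ a := by
      let Z := A.filter fun i => μ i = μ a
      have haZ : a ∈ Z := by simp [Z, haA]
      obtain ⟨g, hg1, hg2⟩ := exists_dirichlet hr hirr ⟨a, haZ⟩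
        (fun i => if i ∈ A \ Z then -1 else 0)
      have hgA : ∀ k ∉ A, gen r g k = 0 := fun k hk => by
        rw [hg2 k (fun h => hk (mem_filter.1 h).1)]
        simp [hk]
      have hgeq : g = fun k => ∑ j ∈ A, g j * ind A j k :=
        funext fun k => eq_sum_ind hr hirr hind hA hgA k
      have hz : ∑ i ∈ A, (μ a - μ i) * gen r g i = 0 := by
        rw [hgeq]
        simp only [gen_sum_mul, mul_sum]
        rw [sum_comm]
        refine sum_eq_zero fun j hj => ?_
        have e1 := hlam j hj
        rw [lamA_eq_sum_gen hr hdiag hirr hind hj] at e1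
        have e2 := hsum j hj
        have : ∑ i ∈ A, (μ a - μ i) * (g j * gen r (ind A j) i)
            = g j * (μ a * ∑ i ∈ A, gen r (ind A j) i - ∑ i ∈ A, μ i * gen r (ind A j) i) := by
          rw [mul_sum, ← sum_sub_distrib, mul_sum]
          exact sum_congr rfl fun _ _ => by ring
        rw [this, e1, e2]
        ring
      have hz' : ∑ i ∈ A, (μ a - μ i) = 0 := by
        rw [← neg_eq_zero, ← hz, ← sum_neg_distrib]
        refine sum_congr rfl fun i hi => ?_
        by_cases hiZ : i ∈ Z
        · rw [(mem_filter.1 hiZ).2]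
          ring
        · rw [hg2 i hiZ]
          simp [hi, hiZ]
      intro i hi
      have := (sum_eq_zero_iff_of_nonneg fun i hi => sub_nonneg.2 (ha i hi)).1 hz' i hi
      linarith
    obtain ⟨hq1, hq2⟩ := hequil (μ a) (hμ_pos a) hconst
    intro i hi k
    rw [hconst i hi]
    by_cases hk : k ∈ A
    · exact ha k hk
    rcases habs with rfl | habs
    · exact absurd (mem_univ k) hk
    have h1 := habs k hk
    rw [lamA_eq_sum_gen hr hdiag hirr hind (mem_insert_self k A),
      sum_gen_ind_insert hind hq1 (fun k _ => hq2 k) hk] at h1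
    have h2 := gen_ind_insert_neg hr hirr hind hA hk
    have h3 : (μ a)⁻¹ * μ k ≤ 1 := by
      simp only [Pi.smul_apply, smul_eq_mul] at h1
      nlinarith
    rwa [inv_mul_le_iff₀ (hμ_pos a), mul_one] at h3
  · intro h
    obtain ⟨a, haA⟩ := hA
    have hconst : ∀ i ∈ A, μ i = μ a := fun i hi => le_antisymm (h a haA i) (h i hi a)
    obtain ⟨hq1, hq2⟩ := hequil (μ a) (hμ_pos a) hconst
    refine ⟨(isAbsorbing_iff hr hdiag hirr hind hμ_pos hμ ⟨a, haA⟩).2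
      ⟨(μ a)⁻¹ • μ, hq1, fun k _ => hq2 k, fun k => ?_⟩, fun j hj => ?_⟩
    · rw [Pi.smul_apply, smul_eq_mul, inv_mul_le_iff₀ (hμ_pos a), mul_one]
      exact h a haA k
    · have h1 := hsum j hj
      rw [sum_congr rfl fun i hi => by rw [hconst i hi], ← mul_sum] at h1
      rw [lamA_eq_sum_gen hr hdiag hirr hind hj]
      exact (mul_eq_zero.1 h1).resolve_left (hμ_pos a).ne'

end Trace

section Existence

variable {V : Type*} [Fintype V] [DecidableEq V]

lemma MemD.continuousOn_fderiv {r : V → V → ℝ} {B : Finset V} {f : (V → ℝ) → ℝ}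
    (hf : MemD r B f) {ζ : ℝ → V → ℝ} {s : Set ℝ} (hζ : ContinuousOn ζ s)
    (hmem : ∀ t ∈ s, ζ t ∈ stdSimplex ℝ V) (d : V → ℝ) :
    ContinuousOn (fun t => fderiv ℝ f (ζ t) d) s := by
  obtain ⟨⟨U, hU, hsub, hC⟩, -⟩ := hf
  exact ((hC.continuousOn_fderiv_of_isOpen hU le_rfl).comp hζ
    fun t ht => hsub (hmem t ht)).clm_apply continuousOn_const

lemma fderiv_flow_eq {r : V → V → ℝ} {f : (V → ℝ) → ℝ} (hf : MemD r univ f) {x : V → ℝ}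
    (hx : x ∈ stdSimplex ℝ V) {p : V → ℝ} (hp : ∀ i, x i = 0 ∨ p i = 1) :
    fderiv ℝ f x (flow r p) = fderiv ℝ f x (lamV r) := by
  rw [lamV_eq_flow_one, ← sum_smul_vvec, ← sum_smul_vvec, map_sum, map_sum]
  refine sum_congr rfl fun i _ => ?_
  rw [map_smul, map_smul]
  rcases hp i with h | h
  · rw [hf.2 i (mem_univ i) x hx h]
    simp
  · simp [h]

lemma MemD.eq_add_integral_of_linear {r : V → V → ℝ} {f : (V → ℝ) → ℝ} (hf : MemD r univ f)
    {u p : V → ℝ} {t : ℝ} (ht : 0 ≤ t)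
    (hmem : ∀ s ∈ Set.Icc 0 t, u + s • flow r p ∈ stdSimplex ℝ V)
    (hp : ∀ i, p i = 1 ∨ ∀ s ∈ Set.Icc 0 t, (u + s • flow r p) i = 0) :
    f (u + t • flow r p)
      = f u + ∫ s in (0:ℝ)..t, fderiv ℝ f (u + s • flow r p) (lamV r) := by
  have hcont : Continuous fun s : ℝ => u + s • flow r p := by fun_prop
  have hu : Set.uIcc 0 t = Set.Icc 0 t := Set.uIcc_of_le ht
  have hderiv : ∀ s ∈ Set.uIcc 0 t, HasDerivAt (fun s : ℝ => f (u + s • flow r p))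
      (fderiv ℝ f (u + s • flow r p) (lamV r)) s := by
    intro s hs
    rw [hu] at hs
    rw [← fderiv_flow_eq hf (hmem s hs) fun i => (hp i).symm.imp (fun h => h s hs) id]
    obtain ⟨⟨U, hU, hsub, hC⟩, -⟩ := hf
    have hd : DifferentiableAt ℝ f (u + s • flow r p) :=
      (hC.differentiableOn one_ne_zero).differentiableAt (hU.mem_nhds (hsub (hmem s hs)))
    have h1 : HasDerivAt (fun s : ℝ => u + s • flow r p) (flow r p) s := by
      simpa using ((hasDerivAt_id s).smul_const (flow r p)).const_add u
    exact hd.hasFDerivAt.comp_hasDerivAt s h1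
  have hint : IntervalIntegrable (fun s => fderiv ℝ f (u + s • flow r p) (lamV r))
      MeasureTheory.volume 0 t := by
    refine ContinuousOn.intervalIntegrable ?_
    rw [hu]
    exact hf.continuousOn_fderiv hcont.continuousOn hmem _
  have h := intervalIntegral.integral_eq_sub_of_hasDerivAt hderiv hint
  simp only [zero_smul, add_zero] at h
  rw [h]
  ring

/-- Follow the straight line with velocity `flow r p` up to time `T`, then the path `ζ`. -/
lemma exists_concat {r : V → V → ℝ} {u p : V → ℝ} {T : ℝ} (hT : 0 ≤ T)
    (hmem : ∀ s ∈ Set.Icc 0 T, u + s • flow r p ∈ stdSimplex ℝ V)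
    (hp : ∀ i, p i = 1 ∨ ∀ s ∈ Set.Icc 0 T, (u + s • flow r p) i = 0)
    {ζ : ℝ → V → ℝ} (hζ : IsPath ζ) (hζ0 : ζ 0 = u + T • flow r p) (hA : CondA r ζ) :
    ∃ ξ : ℝ → V → ℝ, IsPath ξ ∧ (∀ s ∈ Set.Icc 0 T, ξ s = u + s • flow r p) ∧ CondA r ξ := by
  let ξ : ℝ → V → ℝ := fun t => u + (min t T) • flow r p + (ζ (max (t - T) 0) - ζ 0)
  have hξ1 : ∀ s, s ≤ T → ξ s = u + s • flow r p := fun s hs => by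
    simp [ξ, min_eq_left hs, max_eq_right (sub_nonpos.2 hs)]
  have hξ2 : ∀ s, T ≤ s → ξ s = ζ (s - T) := fun s hs => by
    simp [ξ, min_eq_right hs, max_eq_left (sub_nonneg.2 hs), hζ0]
  have hpath : IsPath ξ := by
    constructor
    · have h1 : Continuous fun t : ℝ => ζ (max (t - T) 0) :=
        hζ.1.comp_continuous (by fun_prop) fun t => Set.mem_Ici.2 (le_max_right _ _)
      have h2 : Continuous fun t : ℝ => u + (min t T) • flow r p :=
        continuous_const.add ((continuous_id.min continuous_const).smul continuous_const)
      exact (h2.add (h1.sub continuous_const)).continuousOn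
    · intro t ht
      rcases le_total t T with h | h
      · rw [hξ1 t h]
        exact hmem t ⟨ht, h⟩
      · rw [hξ2 t h]
        exact hζ.2 _ (sub_nonneg.2 h)
  refine ⟨ξ, hpath, fun s hs => hξ1 s hs.2, fun f hf t ht => ?_⟩
  have hfirst : ∀ t, 0 ≤ t → t ≤ T →
      f (ξ t) = f (ξ 0) + ∫ s in (0:ℝ)..t, fderiv ℝ f (ξ s) (lamV r) := by
    intro t ht htT
    have h := hf.eq_add_integral_of_linear ht
      (fun s hs => hmem s ⟨hs.1, hs.2.trans htT⟩)
      (fun i => (hp i).imp id fun h s hs => h s ⟨hs.1, hs.2.trans htT⟩)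
    rw [hξ1 t htT, h, hξ1 0 hT, zero_smul, add_zero]
    congr 1
    refine intervalIntegral.integral_congr fun s hs => ?_
    rw [Set.uIcc_of_le ht] at hs
    simp only [hξ1 s (hs.2.trans htT)]
  rcases le_total t T with htT | htT
  · exact hfirst t ht htT
  have hcont := hf.continuousOn_fderiv hpath.1 (fun t ht => hpath.2 t ht) (lamV r)
  have hint : ∀ a b : ℝ, 0 ≤ a → 0 ≤ b → IntervalIntegrable
      (fun s => fderiv ℝ f (ξ s) (lamV r)) MeasureTheory.volume a b := fun a b ha hb =>
    (hcont.mono fun s hs => (le_min ha hb).trans hs.1).intervalIntegrable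
  have hsecond := hA f hf (t - T) (sub_nonneg.2 htT)
  have hshift : ∫ s in (0:ℝ)..(t - T), fderiv ℝ f (ζ s) (lamV r)
      = ∫ s in T..t, fderiv ℝ f (ξ s) (lamV r) := by
    have h1 := intervalIntegral.integral_comp_sub_right (a := T) (b := t)
      (fun s => fderiv ℝ f (ζ s) (lamV r)) T
    rw [sub_self] at h1
    rw [← h1]
    refine intervalIntegral.integral_congr fun s hs => ?_
    rw [Set.uIcc_of_le htT] at hs
    simp only [hξ2 s hs.1]
  have hTT : ζ 0 = ξ T := by rw [hξ2 T le_rfl, sub_self]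
  rw [← intervalIntegral.integral_add_adjacent_intervals (hint 0 T le_rfl hT) (hint T t hT ht),
    ← hshift, ← add_assoc, ← hfirst T hT le_rfl, hξ2 t htT, hsecond, hTT]

omit [DecidableEq V] in
lemma mem_suppF {u : V → ℝ} {i : V} : i ∈ suppF u ↔ 0 < u i := by
  simp [suppF]

/-- From a point `u` of the face of an absorbing set `B`, which moves into the interior of that
face, there starts a solution. -/
lemma exists_solution {r : V → V → ℝ} (hr : ∀ i j, 0 ≤ r i j) (hdiag : ∀ i, r i i = 0)
    (hirr : IrreducibleRates r) {ind : Finset V → V → V → ℝ} (hind : IsHarmFamily r ind)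
    {μ : V → ℝ} (hμ_pos : ∀ i, 0 < μ i) (hμ : flow r μ = 0) (n : ℕ) :
    ∀ (B : Finset V), #B ≤ n → ∀ p, IsEquilibrium r B p → ∀ u ∈ stdSimplex ℝ V,
      (∀ i ∉ B, u i = 0) → (∀ i ∈ B, u i = 0 → 0 < flow r p i) →
      ∃ ζ : ℝ → V → ℝ, IsPath ζ ∧ ζ 0 = u ∧ CondA r ζ ∧ CondB r ind ζ := by
  induction n with
  | zero =>
    intro B hB p hp u hu hout _
    have h1 : B = ∅ := by simpa using hB
    have h2 := hu.2
    rw [sum_eq_zero fun i _ => hout i (by simp [h1])] at h2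
    exact absurd h2 (by norm_num)
  | succ n ih =>
    intro B hBn p hp u hu hout hin
    have hsupp : ∀ x ∈ stdSimplex ℝ V, (∀ i, i ∈ B ↔ 0 < x i) → x ∈ SigmaAbs r ind := by
      intro x hx h
      have hB : suppF x = B := by
        ext i
        rw [mem_suppF, h i]
      have hne : B.Nonempty := by
        by_contra hemp
        rw [not_nonempty_iff_eq_empty] at hemp
        have h2 := hx.2
        rw [sum_eq_zero fun i _ => le_antisymm
          (not_lt.1 fun h' => by simpa [hemp] using (h i).2 h') (hx.1 i)] at h2
        exact absurd h2 (by norm_num)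
      refine ⟨hx, ?_⟩
      rw [hB]
      exact (isAbsorbing_iff hr hdiag hirr hind hμ_pos hμ hne).2 ⟨p, hp⟩
    let d := flow r p
    have hdout : ∀ i ∉ B, d i = 0 := hp.2.1
    have hdsum : ∑ i, d i = 0 := sum_flow r p
    by_cases hd : ∀ i, 0 ≤ d i
    · have hd0 : ∀ i, d i = 0 := fun i =>
        (sum_eq_zero_iff_of_nonneg fun i _ => hd i).1 hdsum i (mem_univ i)
      have hd0' : flow r p = 0 := funext hd0
      refine ⟨fun _ => u, ⟨continuousOn_const, fun _ _ => hu⟩, rfl, fun f hf t ht => ?_,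
        fun ε hε => ⟨0, le_rfl, hε, hsupp u hu fun i => ⟨fun hi => ?_, fun hi => ?_⟩⟩⟩
      · have h := hf.eq_add_integral_of_linear (u := u) (p := p) ht
          (fun s _ => by simpa [hd0'] using hu)
          (fun i => by
            by_cases hi : i ∈ B
            · exact Or.inl (hp.1 i hi)
            · exact Or.inr fun s _ => by simp [hd0', hout i hi])
        simpa [hd0'] using h
      · refine lt_of_le_of_ne (hu.1 i) fun h => ?_
        have := hin i hi h.symm
        rw [hd0'] at this
        exact lt_irrefl _ this
      · by_contra hiB
        rw [hout i hiB] at hi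
        exact lt_irrefl _ hi
    push Not at hd
    let N := univ.filter fun i => d i < 0
    have hN : N.Nonempty := by
      obtain ⟨i, hi⟩ := hd
      exact ⟨i, by simpa [N] using hi⟩
    have hNB : ∀ i ∈ N, i ∈ B := by
      intro i hi
      by_contra h
      have := (mem_filter.1 hi).2
      rw [hdout i h] at this
      exact lt_irrefl _ this
    obtain ⟨a, haN, ha⟩ := exists_min_image N (fun i => u i / -d i) hN
    have hda : d a < 0 := (mem_filter.1 haN).2
    have hua : 0 < u a := by
      refine lt_of_le_of_ne (hu.1 a) fun h => ?_
      have h1 : 0 < d a := hin a (hNB a haN) h.symm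
      linarith
    set T := u a / -d a with hTdef
    have hT : 0 < T := div_pos hua (neg_pos.2 hda)
    have hTa : u a + T * d a = 0 := by
      rw [hTdef, div_neg, neg_mul, div_mul_cancel₀ _ hda.ne, add_neg_cancel]
    have hN_le : ∀ i ∈ N, 0 ≤ u i + T * d i := by
      intro i hi
      have h1 := ha i hi
      have h2 : d i < 0 := (mem_filter.1 hi).2
      rw [le_div_iff₀ (neg_pos.2 h2)] at h1
      linarith
    have hnn : ∀ s ∈ Set.Icc 0 T, ∀ i, 0 ≤ u i + s * d i := by
      intro s hs i
      by_cases hi : i ∈ N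
      · have h1 := hN_le i hi
        have h2 : d i < 0 := (mem_filter.1 hi).2
        nlinarith [hs.2]
      · have h2 : 0 ≤ d i := by simpa [N] using hi
        have := mul_nonneg hs.1 h2
        linarith [hu.1 i]
    have hpos : ∀ s ∈ Set.Ioo 0 T, ∀ i ∈ B, 0 < u i + s * d i := by
      intro s hs i hiB
      by_cases hi : i ∈ N
      · have h1 := hN_le i hi
        have h2 : d i < 0 := (mem_filter.1 hi).2
        nlinarith [hs.2]
      · have h2 : 0 ≤ d i := by simpa [N] using hi
        rcases (hu.1 i).eq_or_lt with h | h
        · rw [← h, zero_add]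
          exact mul_pos hs.1 (hin i hiB h.symm)
        · have := mul_nonneg hs.1.le h2
          linarith
    have hmem : ∀ s ∈ Set.Icc 0 T, u + s • flow r p ∈ stdSimplex ℝ V := by
      intro s hs
      refine ⟨fun i => hnn s hs i, ?_⟩
      simp only [Pi.add_apply, Pi.smul_apply, smul_eq_mul, sum_add_distrib, ← mul_sum]
      rw [show ∑ i, flow r p i = 0 from hdsum, hu.2]
      ring
    have hzero : ∀ s : ℝ, ∀ i ∉ B, (u + s • flow r p) i = 0 := by
      intro s i hi
      simp [hout i hi, show flow r p i = 0 from hdout i hi]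
    let w := u + T • flow r p
    have hw : w ∈ stdSimplex ℝ V := hmem T ⟨hT.le, le_rfl⟩
    have hwa : w a = 0 := hTa
    have hsub : suppF w ⊆ B := by
      intro i hi
      by_contra hiB
      rw [mem_suppF, show w i = 0 from hzero T i hiB] at hi
      exact lt_irrefl _ hi
    have haS : a ∉ suppF w := by
      rw [mem_suppF, hwa]
      exact lt_irrefl _
    have hne : (suppF w).Nonempty := by
      by_contra hemp
      rw [not_nonempty_iff_eq_empty] at hemp
      have h2 := hw.2
      rw [sum_eq_zero fun i _ => le_antisymm
        (not_lt.1 fun h' => by simpa [hemp] using mem_suppF.2 h') (hw.1 i)] at h2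
      exact absurd h2 (by norm_num)
    obtain ⟨p', hp'⟩ := hp.exists_subset hr hirr hμ_pos hμ hne hsub (fun k hkB hk => by
      rw [mem_suppF, not_lt] at hk
      by_contra! hpos'
      have h1 : w k = u k + T * d k := rfl
      have h2 : 0 < T * d k := mul_pos hT hpos'
      linarith [hu.1 k])
    have hcard : #(suppF w) ≤ n := by
      have : #(suppF w) < #B := card_lt_card ⟨hsub, fun h => haS (h (hNB a haN))⟩
      omega
    obtain ⟨ζ, hζ, hζ0, hζA, -⟩ := ih (suppF w) hcard p' hp' w hw
      (fun i hi => le_antisymm (not_lt.1 fun h => hi (mem_suppF.2 h)) (hw.1 i))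
      (fun i hi h => absurd h (mem_suppF.1 hi).ne')
    obtain ⟨ξ, hξ, hξ1, hξA⟩ := exists_concat hT.le hmem
      (fun i => by
        by_cases hi : i ∈ B
        · exact Or.inl (hp.1 i hi)
        · exact Or.inr fun s _ => hzero s i hi) hζ hζ0 hζA
    refine ⟨ξ, hξ, by rw [hξ1 0 ⟨le_rfl, hT.le⟩, zero_smul, add_zero], hξA, fun ε hε => ?_⟩
    have hm : 0 < min (ε / 2) (T / 2) := by positivity
    have hmT : min (ε / 2) (T / 2) < T := (min_le_right _ _).trans_lt (by linarith)
    refine ⟨min (ε / 2) (T / 2), hm.le, (min_le_left _ _).trans_lt (by linarith), ?_⟩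
    rw [hξ1 _ ⟨hm.le, hmT.le⟩]
    refine hsupp _ (hmem _ ⟨hm.le, hmT.le⟩) fun i => ⟨fun hi => hpos _ ⟨hm, hmT⟩ i hi, fun hi => ?_⟩
    by_contra hiB
    rw [hzero _ i hiB] at hi
    exact lt_irrefl _ hi

lemma suppF_single (i : V) : suppF (Pi.single i 1 : V → ℝ) = {i} := by
  ext j
  rw [mem_suppF, mem_singleton]
  by_cases h : j = i
  · subst h
    simp
  · simp [h]

/-- There is a solution started at each vertex of the simplex. -/
lemma exists_solution_single {r : V → V → ℝ} (hr : ∀ i j, 0 ≤ r i j) (hdiag : ∀ i, r i i = 0)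
    (hirr : IrreducibleRates r) {ind : Finset V → V → V → ℝ} (hind : IsHarmFamily r ind)
    {μ : V → ℝ} (hμ_pos : ∀ i, 0 < μ i) (hμ : flow r μ = 0) (a : V) :
    ∃ ζ : ℝ → V → ℝ, IsPath ζ ∧ ζ 0 = Pi.single a 1 ∧ CondA r ζ ∧ CondB r ind ζ := by
  classical
  let 𝒞 := (univ : Finset (Finset V)).filter fun B => a ∈ B ∧ ∃ p, IsEquilibrium r B p
  have hne : 𝒞.Nonempty := ⟨univ, by
    simp only [𝒞, mem_filter, mem_univ, true_and]
    exact ⟨fun _ => 1, fun _ _ => rfl, fun k hk => absurd (mem_univ k) hk, fun _ => le_rfl⟩⟩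
  obtain ⟨B, hB, hmin⟩ := exists_min_image 𝒞 card hne
  obtain ⟨-, haB, p, hp⟩ := mem_filter.1 hB
  refine exists_solution hr hdiag hirr hind hμ_pos hμ _ B le_rfl p hp _
    (single_mem_stdSimplex ℝ a) (fun i hi => ?_) (fun i hi h0 => ?_)
  · rw [Pi.single_eq_of_ne]
    rintro rfl
    exact hi haB
  · have hia : i ≠ a := by
      rintro rfl
      simp at h0
    by_contra! hneg
    have haB' : a ∈ B.erase i := mem_erase.2 ⟨hia.symm, haB⟩
    have h1 := hmin (B.erase i) (mem_filter.2 ⟨mem_univ _, haB',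
      hp.exists_subset hr hirr hμ_pos hμ ⟨a, haB'⟩ (erase_subset _ _) fun k hk hk' => by
        have : k = i := by
          by_contra hki
          exact hk' (mem_erase.2 ⟨hki, hk⟩)
        rw [this]
        exact hneg⟩)
    have h2 := card_erase_lt_of_mem hi
    omega

end Existence

section Rigidity

variable {V : Type*} [Fintype V] [DecidableEq V]

/-- Truncations `g T` of a strictly superharmonic function `g univ` vanishing on `S`. -/
lemma exists_truncations {r : V → V → ℝ} (hr : ∀ i j, 0 ≤ r i j) (hirr : IrreducibleRates r)
    {S : Finset V} (hS : S.Nonempty) :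
    ∃ (c : ℝ) (g : Finset V → V → ℝ), 0 < c ∧ (∀ T k, 0 ≤ g T k) ∧ (∀ T, ∀ k ∈ S, g T k = 0) ∧
      (∀ T, ∀ k ∈ T, g T k = g univ k) ∧
      (∀ T, ∀ k ∉ T, k ∉ S → g T k + c ≤ g univ k) ∧
      (∀ T, ∀ k ∉ T, k ∉ S → gen r (g T) k = 0) ∧ ∀ T, ∀ k ∉ S, gen r (g T) k ≤ 0 := by
  obtain ⟨g₀, h1, h2⟩ := exists_dirichlet hr hirr hS (fun i => if i ∈ S then 0 else -1)
  have hg0S : ∀ k ∈ S, g₀ k = 0 := fun k hk => by simp [h1 k hk, hk]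
  have hg0L : ∀ k ∉ S, gen r g₀ k = -1 := fun k hk => by simp [h2 k hk, hk]
  have hex : ∀ T : Finset V, ∃ g : V → ℝ, (∀ i ∈ T ∪ S, g i = g₀ i) ∧
      ∀ i ∉ T ∪ S, gen r g i = 0 := by
    intro T
    obtain ⟨g, hg1, hg2⟩ := exists_dirichlet hr hirr (hS.mono (subset_union_right (s₁ := T)))
      (fun i => if i ∈ T ∪ S then g₀ i else 0)
    exact ⟨g, fun i hi => by rw [hg1 i hi, if_pos hi], fun i hi => by rw [hg2 i hi, if_neg hi]⟩
  choose g hg1 hg2 using hex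
  have huniv : g univ = g₀ := funext fun i => hg1 univ i (by simp)
  have hg0 : ∀ k, 0 ≤ g₀ k := nonneg_of_gen_nonpos hr hirr hS (fun i hi => (hg0S i hi).ge)
    fun i hi => by rw [hg0L i hi]; norm_num
  have hgT : ∀ T k, 0 ≤ g T k := fun T =>
    nonneg_of_gen_nonpos hr hirr (hS.mono (subset_union_right (s₁ := T)))
      (fun i hi => by rw [hg1 T i hi]; exact hg0 i) fun i hi => (hg2 T i hi).le
  have hdiffL : ∀ T, ∀ i ∉ T ∪ S, gen r (g₀ - g T) i = -1 := fun T i hi => by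
    rw [gen_sub, hg2 T i hi, hg0L i fun h => hi (mem_union_right _ h), sub_zero]
  have hdiff : ∀ T k, 0 ≤ (g₀ - g T) k := fun T =>
    nonneg_of_gen_nonpos hr hirr (hS.mono (subset_union_right (s₁ := T)))
      (fun i hi => by simp [hg1 T i hi]) fun i hi => by rw [hdiffL T i hi]; norm_num
  let R := 1 + ∑ i, ∑ k, r i k
  have hR : 0 < R := by
    have : 0 ≤ ∑ i, ∑ k, r i k := sum_nonneg fun i _ => sum_nonneg fun k _ => hr i k
    positivity
  have hlow : ∀ e : V → ℝ, (∀ k, 0 ≤ e k) → ∀ k, gen r e k = -1 → R⁻¹ ≤ e k := by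
    intro e he k hk
    have h3 : -1 ≥ -(e k * ∑ l, r k l) := by
      rw [← hk, gen, mul_sum, ← sum_neg_distrib]
      refine sum_le_sum fun l _ => ?_
      nlinarith [mul_nonneg (hr k l) (he l)]
    have h4 : ∑ l, r k l ≤ R := by
      have := single_le_sum (f := fun i => ∑ l, r i l)
        (fun i _ => sum_nonneg fun l _ => hr i l) (mem_univ k)
      simp only [R]
      linarith
    rw [inv_le_iff_one_le_mul₀ hR]
    nlinarith [he k, mul_le_mul_of_nonneg_left h4 (he k)]
  refine ⟨R⁻¹, g, inv_pos.2 hR, hgT, fun T k hk => ?_, fun T k hk => ?_, fun T k hk hkS => ?_,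
    fun T k hk hkS => hg2 T k (by simp [hk, hkS]), fun T k hk => ?_⟩
  · rw [hg1 T k (mem_union_right _ hk), hg0S k hk]
  · rw [huniv, hg1 T k (mem_union_left _ hk)]
  · have := hlow _ (hdiff T) k (hdiffL T k (by simp [hk, hkS]))
    rw [huniv]
    simp only [Pi.sub_apply] at this
    linarith
  · by_cases hkT : k ∈ T
    · have h3 : gen r (g T) k ≤ gen r g₀ k := by
        refine sum_le_sum fun l _ => mul_le_mul_of_nonneg_left ?_ (hr k l)
        rw [hg1 T k (mem_union_left _ hkT)]
        have := hdiff T l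
        simp only [Pi.sub_apply] at this
        linarith
      rw [hg0L k hk] at h3
      linarith
    · exact (hg2 T k (by simp [hkT, hk])).le

/-- A finite family of superharmonic functions off `S` such that, at a point `x` with `x k = 0`,
the functionals which are not harmonic at `k` are dominated by other members of the family. -/
lemma exists_gauge {r : V → V → ℝ} (hr : ∀ i j, 0 ≤ r i j) (hirr : IrreducibleRates r)
    {S : Finset V} (hS : S.Nonempty) :
    ∃ (c η : ℝ) (g : Finset V → V → ℝ), 0 < c ∧ 0 < η ∧ η ≤ 1 ∧ (∀ T, ∀ k ∈ S, g T k = 0) ∧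
      (∀ k ∉ S, c ≤ g univ k) ∧
      (∀ T, ∀ k ∉ T, k ∉ S → gen r (g T) k = 0) ∧ (∀ T, ∀ k ∉ S, gen r (g T) k ≤ 0) ∧
      ∀ x : V → ℝ, (∀ i, 0 ≤ x i) → ∀ k ∉ S, x k = 0 → ∀ T, k ∈ T →
        ∃ T', (1 + η) * ∑ l, g T l * x l ≤ ∑ l, g T' l * x l := by
  obtain ⟨c, g, hc, hg0, hgS, hgT, hgc, hgL, hgL'⟩ := exists_truncations hr hirr hS
  obtain ⟨C, hC0, hC⟩ : ∃ C, 0 < C ∧ ∀ k, g univ k ≤ C := by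
    refine ⟨1 + ∑ k, g univ k, ?_, fun k => ?_⟩
    · have : 0 ≤ ∑ k, g univ k := sum_nonneg fun k _ => hg0 _ k
      positivity
    · have := single_le_sum (f := g univ) (fun k _ => hg0 _ k) (mem_univ k)
      linarith
  obtain ⟨κ, hκ0, hκ2, hκc⟩ : ∃ κ : ℝ, 0 < κ ∧ κ ≤ 1 / 2 ∧ 16 * C * κ ≤ c :=
    ⟨min (1 / 2) (c / (16 * C)), by positivity, min_le_left _ _, by
      have := min_le_right (1 / 2) (c / (16 * C))
      rwa [le_div_iff₀' (by positivity)] at this⟩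
  let n := Fintype.card V
  let a : Finset V → ℝ := fun T => 1 + κ ^ #T
  have ha1 : ∀ T, 1 ≤ a T := fun T => by
    have : 0 < κ ^ #T := by positivity
    simp only [a]
    linarith
  have ha2 : ∀ T, a T ≤ 2 := fun T => by
    have : κ ^ #T ≤ 1 := pow_le_one₀ hκ0.le (by linarith)
    simp only [a]
    linarith
  have hκn : 0 < κ ^ (n + 1) := by positivity
  have hκn1 : κ ^ (n + 1) ≤ 1 := pow_le_one₀ hκ0.le (by linarith)
  refine ⟨c, κ ^ (n + 1) / 8, fun T => a T • g T, hc, by positivity, by linarith,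
    fun T k hk => by simp [hgS T k hk], fun k hk => ?_, fun T k hk hkS => ?_, fun T k hk => ?_, ?_⟩
  · have h1 := hgc ∅ k (notMem_empty k) hk
    have h2 := hg0 ∅ k
    have h3 := ha1 univ
    simp only [Pi.smul_apply, smul_eq_mul]
    nlinarith
  · rw [gen_smul, hgL T k hk hkS, mul_zero]
  · rw [gen_smul]
    exact mul_nonpos_of_nonneg_of_nonpos (by linarith [ha1 T]) (hgL' T k hk)
  · intro x hx k hkS hxk T hkT
    have hsm : ∀ T', ∑ l, (a T' • g T') l * x l = a T' * ∑ l, g T' l * x l := fun T' => by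
      rw [mul_sum]
      exact sum_congr rfl fun _ _ => by simp only [Pi.smul_apply, smul_eq_mul]; ring
    simp only [hsm]
    set N := ∑ l, g univ l * x l with hN
    set δ := ∑ l, (if l ∈ T ∨ l ∈ S then 0 else x l) with hδ
    have hN0 : 0 ≤ N := sum_nonneg fun l _ => mul_nonneg (hg0 _ l) (hx l)
    have hδ0 : 0 ≤ δ := sum_nonneg fun l _ => by
      split_ifs
      · exact le_rfl
      · exact hx l
    have hT : ∑ l, g T l * x l ≤ N - c * δ := by
      rw [hN, hδ, mul_sum, ← sum_sub_distrib]
      refine sum_le_sum fun l _ => ?_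
      split_ifs with h
      · rcases h with h | h
        · simp [hgT T l h]
        · simp [hgS _ l h]
      · have := hgc T l (fun h' => h (Or.inl h')) fun h' => h (Or.inr h')
        nlinarith [hx l]
    have hTk : N - C * δ ≤ ∑ l, g (T.erase k) l * x l := by
      rw [hN, hδ, mul_sum, ← sum_sub_distrib]
      refine sum_le_sum fun l _ => ?_
      by_cases hlk : l = k
      · simp [hlk, hxk]
      split_ifs with h
      · rcases h with h | h
        · simp [hgT (T.erase k) l (mem_erase.2 ⟨hlk, h⟩)]
        · simp [hgS _ l h]
      · nlinarith [hx l, hC l, mul_nonneg (hg0 (T.erase k) l) (hx l),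
          mul_nonneg (sub_nonneg.2 (hC l)) (hx l)]
    have huk : ∑ l, g (univ.erase k) l * x l = N := by
      refine sum_congr rfl fun l _ => ?_
      by_cases hlk : l = k
      · simp [hlk, hxk]
      · rw [hgT (univ.erase k) l (mem_erase.2 ⟨hlk, mem_univ l⟩)]
    have hcard : #T = #(T.erase k) + 1 := (card_erase_add_one hkT).symm
    set t := #(T.erase k) with ht
    have haT : a T = 1 + κ * κ ^ t := by simp only [a, hcard]; ring
    have haTk : a (T.erase k) = 1 + κ ^ t := rfl
    have hq0 : 0 < κ ^ t := by positivity
    have hηt : κ ^ (n + 1) ≤ κ * κ ^ t := by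
      rw [← pow_succ']
      refine pow_le_pow_of_le_one hκ0.le (by linarith) ?_
      have : #T ≤ n := card_le_univ T
      omega
    set y := ∑ l, g T l * x l
    have hy0 : 0 ≤ y := sum_nonneg fun l _ => mul_nonneg (hg0 _ l) (hx l)
    have hyN : y ≤ N := hT.trans (by nlinarith)
    have hη : κ ^ (n + 1) / 8 * (a T * y) ≤ κ * κ ^ t * N / 4 := by
      have h1 : a T * y ≤ 2 * N := mul_le_mul (ha2 T) hyN hy0 (by norm_num)
      have h2 : κ ^ (n + 1) * (a T * y) ≤ κ * κ ^ t * (2 * N) :=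
        mul_le_mul hηt h1 (mul_nonneg (by linarith [ha1 T]) hy0) (by positivity)
      linarith
    have hqN : 0 ≤ κ ^ t * N := by positivity
    have hκqN : κ * κ ^ t * N ≤ κ ^ t * N / 2 := by nlinarith
    rcases le_total (8 * (C * δ)) (κ ^ t * N) with h | h
    · refine ⟨T.erase k, ?_⟩
      have h1 : a (T.erase k) * (N - C * δ) ≤ a (T.erase k) * ∑ l, g (T.erase k) l * x l :=
        mul_le_mul_of_nonneg_left hTk (by linarith [ha1 (T.erase k)])
      have h2 : a (T.erase k) * (C * δ) ≤ 2 * (C * δ) :=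
        mul_le_mul_of_nonneg_right (ha2 _) (by positivity)
      have h3 : a T * y ≤ a T * N := mul_le_mul_of_nonneg_left hyN (by linarith [ha1 T])
      rw [haT] at h3 hη ⊢
      rw [haTk] at h1 h2 ⊢
      linarith
    · refine ⟨univ.erase k, ?_⟩
      rw [huk]
      have h1 : N ≤ a (univ.erase k) * N := by nlinarith [ha1 (univ.erase k)]
      have h2 : a T * y ≤ a T * (N - c * δ) := mul_le_mul_of_nonneg_left hT (by linarith [ha1 T])
      have h3 : c * δ ≤ a T * (c * δ) := by nlinarith [ha1 T, mul_nonneg hc.le hδ0]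
      have h4 : 16 * C * κ * δ ≤ c * δ := mul_le_mul_of_nonneg_right hκc hδ0
      have h5 : κ * (κ ^ t * N) ≤ κ * (8 * (C * δ)) := mul_le_mul_of_nonneg_left h hκ0.le
      have h6 : a T * N = N + κ * κ ^ t * N := by rw [haT]; ring
      have h7 : 0 ≤ κ * κ ^ t * N := by positivity
      linarith

/-- The squared positive part. -/
noncomputable def posSq (z : ℝ) : ℝ := max z 0 ^ 2

lemma posSq_nonneg (z : ℝ) : 0 ≤ posSq z := sq_nonneg _

lemma posSq_of_nonpos {z : ℝ} (hz : z ≤ 0) : posSq z = 0 := by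
  simp [posSq, max_eq_right hz]

lemma posSq_of_nonneg {z : ℝ} (hz : 0 ≤ z) : posSq z = z ^ 2 := by
  simp [posSq, max_eq_left hz]

lemma hasDerivAt_posSq (z : ℝ) : HasDerivAt posSq (2 * max z 0) z := by
  rcases lt_trichotomy z 0 with h | rfl | h
  · rw [max_eq_right h.le, mul_zero]
    refine (hasDerivAt_const z (0 : ℝ)).congr_of_eventuallyEq ?_
    filter_upwards [Iio_mem_nhds h] with y hy
    exact posSq_of_nonpos (le_of_lt hy)
  · rw [max_self, mul_zero, hasDerivAt_iff_isLittleO_nhds_zero]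
    have h1 : (fun h : ℝ => h ^ 2) =o[nhds 0] fun h : ℝ => h := by
      simpa using Asymptotics.isLittleO_pow_pow (𝕜 := ℝ) (one_lt_two : 1 < 2)
    refine Asymptotics.IsBigO.trans_isLittleO (Asymptotics.isBigO_of_le _ fun h => ?_) h1
    rw [posSq_of_nonpos le_rfl, zero_add, smul_zero, sub_zero, sub_zero,
      Real.norm_of_nonneg (posSq_nonneg _),
      Real.norm_of_nonneg (sq_nonneg _)]
    rcases le_total h 0 with h' | h'
    · rw [posSq_of_nonpos h']
      positivity
    · rw [posSq_of_nonneg h']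
  · rw [max_eq_left h.le]
    have h1 : HasDerivAt (fun z : ℝ => z ^ 2) (2 * z) z := by simpa using hasDerivAt_pow 2 z
    refine h1.congr_of_eventuallyEq ?_
    filter_upwards [Ioi_mem_nhds h] with y hy
    exact posSq_of_nonneg (le_of_lt hy)

lemma contDiff_posSq : ContDiff ℝ 1 posSq := by
  rw [contDiff_one_iff_deriv]
  refine ⟨fun z => (hasDerivAt_posSq z).differentiableAt, ?_⟩
  rw [show deriv posSq = fun z => 2 * max z 0 from funext fun z => (hasDerivAt_posSq z).deriv]
  fun_prop

/-- The linear functional with coefficients `g`. -/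
noncomputable def linFun (g : V → ℝ) : (V → ℝ) →L[ℝ] ℝ :=
  ∑ l, g l • ContinuousLinearMap.proj l

omit [DecidableEq V] in
lemma linFun_apply (g u : V → ℝ) : linFun g u = ∑ l, g l * u l := by
  simp [linFun]

/-- A test function whose minimum on the simplex is localized around the face `S`. -/
noncomputable def testFun (g : Finset V → V → ℝ) (h : V → V → ℝ) (S : Finset V) (w : V → ℝ)
    (s : ℝ) (u : V → ℝ) : ℝ :=
  ∑ T, posSq (linFun (g T) u - s) + ∑ j ∈ S, (linFun (h j) u - w j) ^ 2

omit [DecidableEq V] in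
lemma contDiff_testFun (g : Finset V → V → ℝ) (h : V → V → ℝ) (S : Finset V) (w : V → ℝ)
    (s : ℝ) : ContDiff ℝ 1 (testFun g h S w s) := by
  unfold testFun
  refine ContDiff.add (ContDiff.sum fun T _ => ?_) (ContDiff.sum fun j _ => ?_)
  · exact contDiff_posSq.comp ((linFun (g T)).contDiff.sub contDiff_const)
  · exact ((linFun (h j)).contDiff.sub contDiff_const).pow 2

omit [DecidableEq V] in
lemma fderiv_testFun (g : Finset V → V → ℝ) (h : V → V → ℝ) (S : Finset V) (w : V → ℝ)
    (s : ℝ) (u v : V → ℝ) :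
    fderiv ℝ (testFun g h S w s) u v
      = ∑ T, 2 * max (linFun (g T) u - s) 0 * linFun (g T) v
        + ∑ j ∈ S, 2 * (linFun (h j) u - w j) * linFun (h j) v := by
  have h1 : HasFDerivAt (testFun g h S w s)
      (∑ T, (2 * max (linFun (g T) u - s) 0) • linFun (g T)
        + ∑ j ∈ S, (2 * (linFun (h j) u - w j)) • linFun (h j)) u := by
    refine HasFDerivAt.add (HasFDerivAt.fun_sum fun T _ => ?_) (HasFDerivAt.fun_sum fun j _ => ?_)
    · exact (hasDerivAt_posSq _).comp_hasFDerivAt u ((linFun (g T)).hasFDerivAt.sub_const s)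
    · have := ((linFun (h j)).hasFDerivAt (x := u)).sub_const (w j)
      simpa using this.pow 2
  rw [h1.fderiv]
  simp

omit [DecidableEq V] in
lemma testFun_nonneg (g : Finset V → V → ℝ) (h : V → V → ℝ) (S : Finset V) (w : V → ℝ)
    (s : ℝ) (u : V → ℝ) : 0 ≤ testFun g h S w s u :=
  add_nonneg (sum_nonneg fun _ _ => posSq_nonneg _) (sum_nonneg fun _ _ => sq_nonneg _)

omit [DecidableEq V] in
lemma posSq_le_testFun (g : Finset V → V → ℝ) (h : V → V → ℝ) (S : Finset V) (w : V → ℝ)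
    (s : ℝ) (u : V → ℝ) (T : Finset V) : posSq (linFun (g T) u - s) ≤ testFun g h S w s u :=
  (single_le_sum (f := fun T => posSq (linFun (g T) u - s)) (fun _ _ => posSq_nonneg _)
    (mem_univ T)).trans (le_add_of_nonneg_right (sum_nonneg fun _ _ => sq_nonneg _))

omit [DecidableEq V] in
lemma sq_le_testFun (g : Finset V → V → ℝ) (h : V → V → ℝ) (S : Finset V) (w : V → ℝ)
    (s : ℝ) (u : V → ℝ) {j : V} (hj : j ∈ S) :
    (linFun (h j) u - w j) ^ 2 ≤ testFun g h S w s u :=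
  (single_le_sum (f := fun j => (linFun (h j) u - w j) ^ 2) (fun _ _ => sq_nonneg _) hj).trans
    (le_add_of_nonneg_left (sum_nonneg fun _ _ => posSq_nonneg _))

omit [DecidableEq V] in
lemma fderiv_neg_posSq_comp {G : (V → ℝ) → ℝ} (hG : Differentiable ℝ G) (ε : ℝ) (u v : V → ℝ) :
    fderiv ℝ (fun x => -posSq (ε - G x)) u v = 2 * max (ε - G u) 0 * fderiv ℝ G u v := by
  have h1 : HasFDerivAt (fun x => -posSq (ε - G x))
      (-((2 * max (ε - G u) 0) • -fderiv ℝ G u)) u :=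
    ((hasDerivAt_posSq _).comp_hasFDerivAt u ((hG u).hasFDerivAt.const_sub ε)).neg
  rw [h1.fderiv]
  simp

/-- Solutions started from a configuration supported by sites of maximal measure do not move. -/
lemma eq_of_condA {r : V → V → ℝ} (hr : ∀ i j, 0 ≤ r i j) (hirr : IrreducibleRates r)
    {ind : Finset V → V → V → ℝ} (hind : IsHarmFamily r ind)
    {μ : V → ℝ} (hμ_pos : ∀ i, 0 < μ i) (hμ : flow r μ = 0) {w : V → ℝ}
    (hw : w ∈ stdSimplex ℝ V) (hmax : ∀ i, 0 < w i → ∀ k, μ k ≤ μ i)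
    {ζ : ℝ → V → ℝ} (hζ : IsPath ζ) (hζ0 : ζ 0 = w) (hA : CondA r ζ) {t : ℝ} (ht : 0 ≤ t) :
    ζ t = w := by
  set S := suppF w with hSdef
  have hSpos : ∀ i, i ∈ S ↔ 0 < w i := fun i => mem_suppF
  have hSout : ∀ i ∉ S, w i = 0 := fun i hi =>
    le_antisymm (not_lt.1 fun h => hi ((hSpos i).2 h)) (hw.1 i)
  have hS : S.Nonempty := by
    by_contra hemp
    rw [not_nonempty_iff_eq_empty] at hemp
    have h2 := hw.2
    rw [sum_eq_zero fun i _ => hSout i (by simp [hemp])] at h2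
    exact absurd h2 (by norm_num)
  obtain ⟨c, η, g, hc, hη0, hη1, hgS, hgc, hgL, hgL', hdom⟩ := exists_gauge hr hirr hS
  obtain ⟨b, hbS, hb⟩ := exists_min_image S w hS
  have hwb : 0 < w b := (hSpos b).1 hbS
  let h := ind S
  have hhS : ∀ j ∈ S, ∀ i ∈ S, h j i = if i = j then 1 else 0 := fun j hj => (hind S j hj).1
  have hhL : ∀ j ∈ S, ∀ i ∉ S, gen r (h j) i = 0 := fun j hj => (hind S j hj).2
  have hlin : ∀ (f : V → ℝ) i, linFun f (vvec r i) = gen r f i := fun f i => by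
    rw [linFun_apply, sum_mul_vvec]
  have hout_le : ∀ x ∈ stdSimplex ℝ V, ∀ j ∈ S,
      linFun (h j) x ≤ x j + ∑ l ∈ Sᶜ, x l ∧ c * ∑ l ∈ Sᶜ, x l ≤ linFun (g univ) x := by
    intro x hx j hj
    rw [linFun_apply, linFun_apply, ← sum_add_sum_compl S, ← sum_add_sum_compl S]
    constructor
    · refine add_le_add (le_of_eq ?_) (sum_le_sum fun l _ => ?_)
      · rw [sum_congr rfl fun l hl => by rw [hhS j hj l hl]]
        simp [hj]
      · exact mul_le_of_le_one_left (hx.1 l) (ind_le_one hr hirr hind hj l)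
    · have h0 : ∑ l ∈ S, g univ l * x l = 0 :=
        sum_eq_zero fun l hl => by rw [hgS univ l hl, zero_mul]
      rw [h0, zero_add, mul_sum]
      exact sum_le_sum fun l hl => mul_le_mul_of_nonneg_right (hgc l (mem_compl.1 hl)) (hx.1 l)
  have key : ∀ s, 0 < s → 4 * s ≤ c * w b → 2 * s ≤ w b →
      testFun g h S w s (ζ t) = 0 := by
    intro s hs hs1 hs2
    set G := testFun g h S w s with hG
    set ε := (η * s) ^ 2 with hε
    have hε0 : 0 < ε := by positivity
    have hGdiff : Differentiable ℝ G := (contDiff_testFun g h S w s).differentiable one_ne_zero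
    let F : (V → ℝ) → ℝ := fun x => -posSq (ε - G x)
    have hFderiv : ∀ u v, fderiv ℝ F u v = 2 * max (ε - G u) 0 * fderiv ℝ G u v :=
      fun u v => fderiv_neg_posSq_comp hGdiff ε u v
    have hlt_of : ∀ u T, G u < ε → linFun (g T) u - s < η * s := by
      intro u T hu
      by_contra! hle
      have h1 := posSq_le_testFun g h S w s u T
      have h2 : 0 ≤ η * s := by positivity
      rw [posSq_of_nonneg (h2.trans hle)] at h1
      have h3 : (η * s) ^ 2 ≤ (linFun (g T) u - s) ^ 2 := pow_le_pow_left₀ h2 hle 2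
      linarith
    have hMem : MemD r univ F := by
      constructor
      · refine ⟨Set.univ, isOpen_univ, Set.subset_univ _, ContDiff.contDiffOn ?_⟩
        exact (contDiff_posSq.comp (contDiff_const.sub (contDiff_testFun g h S w s))).neg
      · intro i _ u hu hui
        rw [hFderiv]
        rcases le_or_gt ε (G u) with hle | hlt
        · rw [max_eq_right (by linarith)]
          ring
        have hGi : fderiv ℝ G u (vvec r i) = 0 := by
          by_cases hiS : i ∈ S
          · exfalso
            obtain ⟨h1, h2⟩ := hout_le u hu i hiS
            have h3 := hlt_of u univ hlt
            have h4 : η * s ≤ s := by nlinarith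
            have h5 : ∑ l ∈ Sᶜ, u l ≤ w b / 2 := by
              refine le_of_mul_le_mul_left ?_ hc
              linarith
            have h6 := hb i hiS
            have h7 := sq_le_testFun g h S w s u hiS
            have h8 : s ≤ w i - linFun (h i) u := by rw [hui] at h1; linarith
            have h9 : (η * s) ^ 2 ≤ (w i - linFun (h i) u) ^ 2 :=
              pow_le_pow_left₀ (by positivity) (h4.trans h8) 2
            have h10 : (w i - linFun (h i) u) ^ 2 = (linFun (h i) u - w i) ^ 2 := by ring
            linarith
          · rw [hG, fderiv_testFun]
            rw [sum_eq_zero (s := S) fun j hj => by rw [hlin, hhL j hj i hiS, mul_zero], add_zero]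
            refine sum_eq_zero fun T _ => ?_
            rw [hlin]
            by_cases hiT : i ∈ T
            · obtain ⟨T', hT'⟩ := hdom u hu.1 i hiS hui T hiT
              rw [← linFun_apply, ← linFun_apply] at hT'
              have h1 := hlt_of u T' hlt
              have h2 : linFun (g T) u ≤ s := by nlinarith
              rw [max_eq_right (by linarith)]
              ring
            · rw [hgL T i hiT hiS, mul_zero]
        rw [hGi, mul_zero]
    have hdrift : ∀ u ∈ stdSimplex ℝ V, fderiv ℝ F u (lamV r) ≤ 0 := by
      intro u hu
      have hm : ∀ i ∈ S, μ i = μ b := fun i hi =>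
        le_antisymm (hmax b hwb i) (hmax i ((hSpos i).1 hi) b)
      have h1 : lamV r = ∑ i, (1 - μ i / μ b) • vvec r i := by
        have h2 : ∑ i, (μ i / μ b) • vvec r i = 0 := by
          simp only [div_eq_inv_mul, mul_smul]
          rw [← smul_sum, sum_smul_vvec, hμ, smul_zero]
        simp only [sub_smul, sum_sub_distrib, h2, sub_zero, one_smul]
        rw [lamV_eq_flow_one, ← sum_smul_vvec]
        simp
      rw [h1, map_sum]
      refine sum_nonpos fun i _ => ?_
      rw [map_smul, smul_eq_mul]
      by_cases hiS : i ∈ S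
      · rw [hm i hiS, div_self (hμ_pos b).ne']
        simp
      · refine mul_nonpos_of_nonneg_of_nonpos ?_ ?_
        · rw [sub_nonneg, div_le_one (hμ_pos b)]
          exact hmax b hwb i
        · rw [hFderiv]
          refine mul_nonpos_of_nonneg_of_nonpos (by positivity) ?_
          rw [hG, fderiv_testFun]
          rw [sum_eq_zero (s := S) fun j hj => by rw [hlin, hhL j hj i hiS, mul_zero], add_zero]
          refine sum_nonpos fun T _ => ?_
          rw [hlin]
          exact mul_nonpos_of_nonneg_of_nonpos (by positivity) (hgL' T i hiS)
    have hGw : G w = 0 := by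
      rw [hG, testFun]
      have h1 : ∀ T, linFun (g T) w = 0 := fun T => by
        rw [linFun_apply]
        refine sum_eq_zero fun l _ => ?_
        by_cases hl : l ∈ S
        · rw [hgS T l hl, zero_mul]
        · rw [hSout l hl, mul_zero]
      have h2 : ∀ j ∈ S, linFun (h j) w = w j := fun j hj => by
        rw [linFun_apply, ← sum_add_sum_compl S, sum_congr rfl fun l hl => by rw [hhS j hj l hl],
          sum_eq_zero (s := Sᶜ) fun l hl => by rw [hSout l (mem_compl.1 hl), mul_zero]]
        simp [hj]
      rw [sum_eq_zero fun T _ => by rw [h1 T, posSq_of_nonpos (by linarith)],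
        sum_eq_zero fun j hj => by rw [h2 j hj, sub_self, zero_pow two_ne_zero], add_zero]
    have hint : ∫ s in (0:ℝ)..t, fderiv ℝ F (ζ s) (lamV r) ≤ 0 := by
      rw [intervalIntegral.integral_of_le ht]
      exact MeasureTheory.setIntegral_nonpos measurableSet_Ioc fun x hx =>
        hdrift _ (hζ.2 x hx.1.le)
    have hF := hA F hMem t ht
    have h1 : posSq ε ≤ posSq (ε - G (ζ t)) := by
      have h2 : F (ζ 0) = -posSq ε := by simp only [F, hζ0, hGw, sub_zero]
      have h3 : F (ζ t) = -posSq (ε - G (ζ t)) := rfl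
      linarith
    have h4 := testFun_nonneg g h S w s (ζ t)
    rw [posSq_of_nonneg hε0.le] at h1
    rcases le_total (ε - G (ζ t)) 0 with h5 | h5
    · rw [posSq_of_nonpos h5] at h1
      have : 0 < ε ^ 2 := by positivity
      linarith
    · rw [posSq_of_nonneg h5] at h1
      have := le_of_sq_le_sq h1 h5
      linarith
  have hmem := hζ.2 t ht
  have hz : ∑ l ∈ Sᶜ, ζ t l ≤ 0 := by
    by_contra! hpos
    obtain ⟨s, hs0, hs1, hs2, hs3⟩ : ∃ s, 0 < s ∧ 4 * s ≤ c * w b ∧ 2 * s ≤ w b ∧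
        2 * s ≤ c * ∑ l ∈ Sᶜ, ζ t l := by
      refine ⟨min (c * w b / 4) (min (w b / 2) (c * (∑ l ∈ Sᶜ, ζ t l) / 2)), by positivity, ?_, ?_,
        ?_⟩
      · linarith [min_le_left (c * w b / 4) (min (w b / 2) (c * (∑ l ∈ Sᶜ, ζ t l) / 2))]
      · linarith [min_le_right (c * w b / 4) (min (w b / 2) (c * (∑ l ∈ Sᶜ, ζ t l) / 2)),
          min_le_left (w b / 2) (c * (∑ l ∈ Sᶜ, ζ t l) / 2)]
      · linarith [min_le_right (c * w b / 4) (min (w b / 2) (c * (∑ l ∈ Sᶜ, ζ t l) / 2)),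
          min_le_right (w b / 2) (c * (∑ l ∈ Sᶜ, ζ t l) / 2)]
    have h1 := posSq_le_testFun g h S w s (ζ t) univ
    have h2 := (hout_le _ hmem b hbS).2
    rw [key s hs0 hs1 hs2, posSq_of_nonneg (by linarith)] at h1
    have : 0 < (linFun (g univ) (ζ t) - s) ^ 2 := pow_pos (by linarith) 2
    linarith
  have hzero : ∀ l ∉ S, ζ t l = 0 := fun l hl =>
    (sum_eq_zero_iff_of_nonneg fun i _ => hmem.1 i).1
      (le_antisymm hz (sum_nonneg fun i _ => hmem.1 i)) l (mem_compl.2 hl)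
  ext j
  by_cases hj : j ∈ S
  · obtain ⟨s, hs0, hs1, hs2⟩ : ∃ s, 0 < s ∧ 4 * s ≤ c * w b ∧ 2 * s ≤ w b :=
      ⟨min (c * w b / 4) (w b / 2), by positivity,
        by linarith [min_le_left (c * w b / 4) (w b / 2)],
        by linarith [min_le_right (c * w b / 4) (w b / 2)]⟩
    have h1 := sq_le_testFun g h S w s (ζ t) hj
    rw [key s hs0 hs1 hs2] at h1
    have h2 : linFun (h j) (ζ t) = ζ t j := by
      rw [linFun_apply, ← sum_add_sum_compl S, sum_congr rfl fun l hl => by rw [hhS j hj l hl],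
        sum_eq_zero (s := Sᶜ) fun l hl => by rw [hzero l (mem_compl.1 hl), mul_zero]]
      simp [hj]
    rw [h2] at h1
    have h3 : ζ t j - w j = 0 := pow_eq_zero_iff two_ne_zero |>.1 (le_antisymm h1 (sq_nonneg _))
    linarith
  · rw [hzero j hj, hSout j hj]

end Rigidity

/-- for nonempty `A`, the following are equivalent:
(a) every solution of the `(λ, D_V)`-problem started on the face `∂_AΣ` is constant;
(b) `A` is `r`-absorbing and `λ^A ≡ 0`;
(c) `A ⊆ ℳ`, the set of sites of maximal `μ`-measure. -/
theorem absorbing_face_characterization (V : Type*) [Fintype V] [DecidableEq V] [Nonempty V]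
    (r : V → V → ℝ) (hr_nonneg : ∀ i j, 0 ≤ r i j) (hr_diag : ∀ i, r i i = 0)
    (hr_irr : IrreducibleRates r)
    (ind : Finset V → V → V → ℝ) (hind : IsHarmFamily r ind)
    (μ : V → ℝ) (hμ_pos : ∀ i, 0 < μ i) (hμ_sum : ∑ i, μ i = 1)
    (hμ_inv : ∀ j, ∑ i, (μ i * r i j - μ j * r j i) = 0)
    (A : Finset V) (hA : A.Nonempty) :
    ((∀ u ∈ stdSimplex ℝ V, ∑ j ∈ A, u j = 1 →
        ∀ ζ : ℝ → V → ℝ, IsPath ζ → ζ 0 = u → CondA r ζ → CondB r ind ζ →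
          ∀ t : ℝ, 0 ≤ t → ζ t = u) ↔
      (IsAbsorbing r ind A ∧ ∀ i ∈ A, lamA r ind A i = 0)) ∧
    ((IsAbsorbing r ind A ∧ ∀ i ∈ A, lamA r ind A i = 0) ↔
      (∀ i ∈ A, ∀ k, μ k ≤ μ i)) := by
  have hμ : flow r μ = 0 := funext hμ_inv
  have hbc := fun {B : Finset V} (hB : B.Nonempty) =>
    absorbing_and_lamA_eq_zero_iff hr_nonneg hr_diag hr_irr hind hμ_pos hμ hB
  refine ⟨?_, hbc hA⟩
  rw [hbc hA]
  constructor
  · intro hconst i hi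
    obtain ⟨ζ, hζ, hζ0, hζA, hζB⟩ :=
      exists_solution_single hr_nonneg hr_diag hr_irr hind hμ_pos hμ i
    have hstay := hconst _ (single_mem_stdSimplex ℝ i)
      (by simp [Pi.single_apply, hi]) ζ hζ hζ0 hζA hζB
    obtain ⟨t, ht, -, -, habs⟩ := hζB 1 one_pos
    rw [hstay t ht, suppF_single] at habs
    exact (hbc (singleton_nonempty i)).1 ⟨habs, fun j _ => by simp_all [lamA]⟩ i
      (mem_singleton_self i)
  · intro hmax u hu hsum ζ hζ hζ0 hζA _ t ht
    refine eq_of_condA hr_nonneg hr_irr hind hμ_pos hμ hu (fun i hi => hmax i ?_) hζ hζ0 hζA ht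
    by_contra hiA
    have h1 : ∑ j ∈ Aᶜ, u j = 0 := by
      have := sum_add_sum_compl A u
      linarith [hu.2]
    exact hi.ne' ((sum_eq_zero_iff_of_nonneg fun j _ => hu.1 j).1 h1 i (mem_compl.2 hiA))
end

section
/- Let A ⊆ V be nonempty and B = V∖A. For every h ∈ D_B and every ε > 0 there exists f ∈ D_V such that for every u ∈ Σ with min_{i∈A} u(i) ≥ ε one has f(u) = h(u) and λ(f)(u) = λ(h)(u). -/
open Finset

open Matrix Filter Topology

/-- A matrix with nonpositive off-diagonal entries and nonnegative row sums is inverse-positive on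
columns: a vector with positive image under the transpose is positive. -/
theorem pos_of_transpose_mulVec_pos {V : Type*} [Fintype V] [DecidableEq V] {M : Matrix V V ℝ}
    (hoff : ∀ i j, i ≠ j → M i j ≤ 0) (hrow : ∀ i, 0 ≤ ∑ j, M i j) {a : V → ℝ}
    (ha : ∀ i, 0 < (Mᵀ *ᵥ a) i) (i : V) : 0 < a i := by
  by_contra! hi
  set P : Finset V := univ.filter fun j => a j ≤ 0 with hP
  have hmem : ∀ j, j ∈ P ↔ a j ≤ 0 := by simp [hP]
  have hpos : 0 < ∑ l ∈ P, (Mᵀ *ᵥ a) l :=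
    sum_pos (fun l _ => ha l) ⟨i, (hmem i).2 hi⟩
  have hswap : ∑ l ∈ P, (Mᵀ *ᵥ a) l = ∑ j, a j * ∑ l ∈ P, M j l := by
    simp only [mulVec, dotProduct, transpose_apply, mul_sum]
    rw [sum_comm]
    exact sum_congr rfl fun j _ => sum_congr rfl fun l _ => mul_comm _ _
  have hle : ∑ j, a j * ∑ l ∈ P, M j l ≤ 0 := by
    refine sum_nonpos fun j _ => ?_
    by_cases hj : a j ≤ 0
    · refine mul_nonpos_of_nonpos_of_nonneg hj ?_
      have hcompl : ∑ l ∈ Pᶜ, M j l ≤ 0 := sum_nonpos fun l hl => hoff j l <| by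
        rintro rfl
        exact (mem_compl.1 hl) ((hmem _).2 hj)
      linarith [hrow j, sum_add_sum_compl P (M j)]
    · refine mul_nonpos_of_nonneg_of_nonpos (not_le.1 hj).le (sum_nonpos fun l hl => hoff j l ?_)
      rintro rfl
      exact hj ((hmem _).1 hl)
  linarith

/-- The matrix of minus the generator of `r` on the rows in `S`, and the identity elsewhere. -/
noncomputable def killedMatrix {V : Type*} [Fintype V] [DecidableEq V] (r : V → V → ℝ)
    (S : Set V) : Matrix V V ℝ :=
  open scoped Classical in
  Matrix.of fun i => if i ∈ S then -vvec r i else Pi.single i 1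

section killedMatrix

variable {V : Type*} [Fintype V] [DecidableEq V] {r : V → V → ℝ} {S : Set V}

theorem vvec_apply (i l : V) : vvec r i l = r i l - if l = i then ∑ k, r i k else 0 := by
  simp only [vvec, mul_sub, sum_sub_distrib, mul_ite, mul_one, mul_zero, sum_ite_eq, mem_univ,
    if_true]
  split_ifs <;> simp

theorem sum_vvec (i : V) : ∑ l, vvec r i l = 0 := by
  simp [vvec_apply, sum_sub_distrib]

theorem killedMatrix_row {i : V} (hi : i ∈ S) : killedMatrix r S i = -vvec r i := by
  ext; simp [killedMatrix, hi]

theorem killedMatrix_row_of_notMem {i : V} (hi : i ∉ S) :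
    killedMatrix r S i = Pi.single i 1 := by
  ext; simp [killedMatrix, hi]

theorem killedMatrix_offDiag_nonpos (hr : ∀ i j, 0 ≤ r i j) (i j : V) (hij : i ≠ j) :
    killedMatrix r S i j ≤ 0 := by
  by_cases hi : i ∈ S
  · simp [killedMatrix_row hi, vvec_apply, hij.symm, hr]
  · simp [killedMatrix_row_of_notMem hi, hij.symm]

theorem killedMatrix_rowSum_nonneg (i : V) : 0 ≤ ∑ j, killedMatrix r S i j := by
  by_cases hi : i ∈ S
  · simp [killedMatrix_row hi, sum_vvec]
  · simp [killedMatrix_row_of_notMem hi]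

theorem vvec_dotProduct (i : V) (g : V → ℝ) :
    vvec r i ⬝ᵥ g = ∑ k, r i k * (g k - g i) := by
  simp [dotProduct, vvec_apply, sub_mul, mul_sub, sum_sub_distrib, sum_mul]

/-- Maximum principle: a function in the kernel of `killedMatrix` is nonpositive. -/
theorem nonpos_of_killedMatrix_mulVec_eq_zero (hr : ∀ i j, 0 ≤ r i j) (hirr : IrreducibleRates r)
    {j₀ : V} (hj₀ : j₀ ∉ S) {g : V → ℝ} (hg : killedMatrix r S *ᵥ g = 0) (i : V) : g i ≤ 0 := by
  have hout : ∀ j, j ∉ S → g j = 0 := fun j hj => by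
    simpa [mulVec, killedMatrix_row_of_notMem hj] using congrFun hg j
  have hin : ∀ j, j ∈ S → ∑ k, r j k * (g k - g j) = 0 := fun j hj => by
    have h : killedMatrix r S j ⬝ᵥ g = 0 := congrFun hg j
    rwa [killedMatrix_row hj, neg_dotProduct, neg_eq_zero, vvec_dotProduct] at h
  obtain ⟨p, -, hp⟩ := exists_max_image univ g ⟨i, mem_univ i⟩
  replace hp : ∀ k, g k ≤ g p := fun k => hp k (mem_univ k)
  refine (hp i).trans ?_
  by_contra! hpos
  have hne : p ≠ j₀ := by
    rintro rfl
    exact hpos.ne' (hout _ hj₀)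
  obtain ⟨m, k, hk0, hkm, hk⟩ := hirr p j₀ hne
  have key : ∀ l ≤ m, g (k l) = g p := by
    intro l
    induction l with
    | zero => intro _; rw [hk0]
    | succ l ih =>
      intro hl
      have hgl := ih (by omega)
      have hS : k l ∈ S := by
        by_contra hS
        exact hpos.ne' (hgl ▸ hout _ hS)
      have hz := (sum_eq_zero_iff_of_nonpos (fun x _ =>
        mul_nonpos_of_nonneg_of_nonpos (hr (k l) x)
          (by rw [hgl]; exact sub_nonpos.2 (hp x)))).1 (hin _ hS) (k (l + 1)) (mem_univ _)
      have := (mul_eq_zero.1 hz).resolve_left (hk l (by omega)).ne'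
      linarith
  have := key m le_rfl
  rw [hkm, hout _ hj₀] at this
  exact hpos.ne this

theorem isUnit_killedMatrix (hr : ∀ i j, 0 ≤ r i j) (hirr : IrreducibleRates r)
    {j₀ : V} (hj₀ : j₀ ∉ S) : IsUnit (killedMatrix r S) := by
  rw [← mulVec_injective_iff_isUnit]
  refine (injective_iff_map_eq_zero (mulVecLin (killedMatrix r S))).2 fun g hg => ?_
  ext i
  refine le_antisymm (nonpos_of_killedMatrix_mulVec_eq_zero hr hirr hj₀ hg i) ?_
  have hneg : killedMatrix r S *ᵥ (-g) = 0 := by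
    rw [mulVec_neg, neg_eq_zero]; exact hg
  simpa using nonpos_of_killedMatrix_mulVec_eq_zero hr hirr hj₀ hneg i

end killedMatrix

/-- Inner and outer radii of a box such that, in the box, a vector of the form `Mᵀ t` whose `i`-th
coordinate vanishes has `t i` within the inner radius. -/
theorem exists_box_radii {V : Type*} [Fintype V] [DecidableEq V] {M : Matrix V V ℝ}
    (hM : IsUnit M) (hoff : ∀ i j, i ≠ j → M i j ≤ 0) (hrow : ∀ i, 0 ≤ ∑ j, M i j) :
    ∃ a b : V → ℝ, (∀ i, 0 < b i ∧ b i < a i) ∧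
      ∀ ρ : ℝ, ∀ t : V → ℝ, (∀ j, |t j| < ρ * a j) → ∀ i, (Mᵀ *ᵥ t) i = 0 → |t i| < ρ * b i := by
  obtain ⟨a, ha⟩ : ∃ a : V → ℝ, Mᵀ *ᵥ a = 1 :=
    (mulVec_surjective_iff_isUnit.2 ((isUnit_transpose (A := M)).2 hM)) 1
  have hapos : ∀ i, 0 < a i := pos_of_transpose_mulVec_pos hoff hrow (by simp [ha])
  have hsplit : ∀ t : V → ℝ, ∀ i, (Mᵀ *ᵥ t) i = M i i * t i + ∑ j ∈ univ.erase i, M j i * t j := by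
    intro t i
    simp only [mulVec, dotProduct, transpose_apply]
    rw [add_sum_erase univ (fun j => M j i * t j) (mem_univ i)]
  set c : V → ℝ := fun i => ∑ j ∈ univ.erase i, -M j i * a j with hc
  have hc0 : ∀ i, 0 ≤ c i := fun i => sum_nonneg fun j hj =>
    mul_nonneg (neg_nonneg.2 (hoff j i (ne_of_mem_erase hj))) (hapos j).le
  have hlt : ∀ i, c i < M i i * a i := by
    intro i
    have h1 := hsplit a i
    rw [ha] at h1
    simp only [hc, neg_mul, sum_neg_distrib, Pi.one_apply] at h1 ⊢
    linarith
  have hd : ∀ i, 0 < M i i := fun i =>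
    pos_of_mul_pos_left ((hc0 i).trans_lt (hlt i)) (hapos i).le
  have hex : ∀ i, ∃ b, c i / M i i < b ∧ b < a i := fun i =>
    exists_between ((div_lt_iff₀' (hd i)).2 (hlt i))
  choose b hb1 hb2 using hex
  refine ⟨a, b, fun i => ⟨(div_nonneg (hc0 i) (hd i).le).trans_lt (hb1 i), hb2 i⟩, ?_⟩
  intro ρ t ht i hi
  have hρ : 0 < ρ := pos_of_mul_pos_left ((abs_nonneg _).trans_lt (ht i)) (hapos i).le
  rw [hsplit] at hi
  have hle : M i i * |t i| ≤ ρ * c i := by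
    rw [← abs_of_pos (hd i), ← abs_mul, eq_neg_of_add_eq_zero_left hi, abs_neg, hc, mul_sum]
    refine (abs_sum_le_sum_abs _ _).trans (sum_le_sum fun j hj => ?_)
    have hj' := hoff j i (ne_of_mem_erase hj)
    rw [abs_mul, abs_of_nonpos hj']
    calc -M j i * |t j| ≤ -M j i * (ρ * a j) :=
          mul_le_mul_of_nonneg_left (ht j).le (neg_nonneg.2 hj')
      _ = ρ * (-M j i * a j) := by ring
  have h2 : ρ * c i < M i i * (ρ * b i) := by
    have := mul_lt_mul_of_pos_left ((div_lt_iff₀' (hd i)).1 (hb1 i)) hρ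
    linarith
  exact lt_of_mul_lt_mul_left (hle.trans_lt h2) (hd i).le

/-- Around every point of the simplex there is a bump function in the domain `D_V` which vanishes
on the faces not containing this point. -/
theorem exists_bump {V : Type*} [Fintype V] [DecidableEq V] {r : V → V → ℝ}
    (hr : ∀ i j, 0 ≤ r i j) (hirr : IrreducibleRates r) {u₀ : V → ℝ} (hu₀ : u₀ ∈ stdSimplex ℝ V) :
    ∃ χ : (V → ℝ) → ℝ, ContDiff ℝ 1 χ ∧ (∀ i u, u i = 0 → fderiv ℝ χ u (vvec r i) = 0) ∧
      (∀ i, 0 < u₀ i → ∀ u, u i = 0 → χ u = 0) ∧ ∀ᶠ u in 𝓝 u₀, χ u = 1 := by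
  set S : Set V := {i | u₀ i = 0}
  obtain ⟨j₀, hj₀⟩ : ∃ j₀, j₀ ∉ S := by
    by_contra! hall
    have : ∑ i, u₀ i = 0 := sum_eq_zero fun i _ => hall i
    linarith [hu₀.2]
  set M := killedMatrix r S with hMdef
  have hM : IsUnit M := isUnit_killedMatrix hr hirr hj₀
  obtain ⟨a, b, hab, hbox⟩ := exists_box_radii hM (killedMatrix_offDiag_nonpos hr)
    killedMatrix_rowSum_nonneg
  obtain ⟨ρ, hρsmall, hρ⟩ : ∃ ρ : ℝ,
      (∀ i, 0 < u₀ i → ρ * ∑ j, |M j i| * a j < u₀ i) ∧ 0 < ρ := by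
    have hev : ∀ᶠ ρ : ℝ in 𝓝[>] 0, ∀ i, 0 < u₀ i → ρ * ∑ j, |M j i| * a j < u₀ i := by
      refine eventually_all.2 fun i => ?_
      by_cases hi : 0 < u₀ i
      · have hcont : Tendsto (fun ρ : ℝ => ρ * ∑ j, |M j i| * a j) (𝓝 0) (𝓝 0) := by
          simpa using (continuous_id.mul continuous_const).tendsto
            (f := fun ρ : ℝ => ρ * ∑ j, |M j i| * a j) 0
        filter_upwards [nhdsWithin_le_nhds (hcont.eventually (gt_mem_nhds hi))] with ρ h _
        exact h
      · exact Eventually.of_forall fun _ h => absurd h hi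
    obtain ⟨ρ, h1, h2⟩ := (hev.and self_mem_nhdsWithin).exists
    exact ⟨ρ, h1, h2⟩
  have hMT : IsUnit Mᵀ := (isUnit_transpose (A := M)).2 hM
  have hdet : IsUnit (Mᵀ).det := (isUnit_iff_isUnit_det _).1 hMT
  set T : (V → ℝ) → V → ℝ := fun w => (Mᵀ)⁻¹ *ᵥ w with hT
  have hTinv : ∀ w, Mᵀ *ᵥ T w = w := fun w => by
    simp [hT, mulVec_mulVec, mul_nonsing_inv _ hdet]
  have hTv : ∀ i ∈ S, T (vvec r i) = -Pi.single i 1 := by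
    intro i hi
    have h1 : vvec r i = Mᵀ *ᵥ (-Pi.single i 1) := by
      rw [mulVec_neg, mulVec_single_one]
      ext l
      simp [hMdef, killedMatrix_row hi, col]
    rw [h1, hT]
    simp [mulVec_mulVec, nonsing_inv_mul _ hdet]
  have hTcont : ContDiff ℝ 1 T := (mulVecLin (Mᵀ)⁻¹).toContinuousLinearMap.contDiff
  let β : ∀ _ : V, ContDiffBump (0 : ℝ) := fun j =>
    ⟨ρ * b j, ρ * a j, mul_pos hρ (hab j).1, mul_lt_mul_of_pos_left (hab j).2 hρ⟩
  set χ : (V → ℝ) → ℝ := fun u => ∏ j, β j (T (u - u₀) j) with hχ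
  have hχcont : ContDiff ℝ 1 χ := contDiff_prod fun j _ =>
    (β j).contDiff.comp ((contDiff_apply ℝ ℝ j).comp
      (hTcont.comp (contDiff_id.sub contDiff_const)))
  have hχ0 : ∀ u, 0 ≤ χ u := fun u => prod_nonneg fun j _ => (β j).nonneg
  have hbox' : ∀ u, χ u ≠ 0 → ∀ j, |T (u - u₀) j| < ρ * a j := by
    intro u hu j
    have hne : β j (T (u - u₀) j) ≠ 0 := (prod_ne_zero_iff.1 hu) j (mem_univ j)
    have hmem : T (u - u₀) j ∈ Function.support (β j) := hne
    rw [(β j).support_eq] at hmem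
    simpa [β] using hmem
  have hface : ∀ i, 0 < u₀ i → ∀ u, u i = 0 → χ u = 0 := by
    intro i hi u hu
    by_contra hne
    have h1 : (Mᵀ *ᵥ T (u - u₀)) i = -u₀ i := by rw [hTinv]; simp [hu]
    have h2 : |(Mᵀ *ᵥ T (u - u₀)) i| ≤ ρ * ∑ j, |M j i| * a j := by
      simp only [mulVec, dotProduct, transpose_apply, mul_sum]
      refine (abs_sum_le_sum_abs _ _).trans (sum_le_sum fun j _ => ?_)
      rw [abs_mul, mul_left_comm]
      exact mul_le_mul_of_nonneg_left (hbox' u hne j).le (abs_nonneg _)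
    rw [h1, abs_neg, abs_of_pos hi] at h2
    exact (hρsmall i hi).not_ge h2
  have hline : ∀ u v, fderiv ℝ χ u v = lineDeriv ℝ χ u v := fun u v =>
    ((hχcont.differentiable one_ne_zero u).lineDeriv_eq_fderiv).symm
  refine ⟨χ, hχcont, fun i u hu => ?_, hface, ?_⟩
  · by_cases hne : χ u = 0
    · have hmin : IsLocalMin χ u := Eventually.of_forall fun w => by rw [hne]; exact hχ0 w
      simp [hmin.fderiv_eq_zero]
    have hi : i ∈ S := by
      by_contra hi
      exact hne (hface i (lt_of_le_of_ne (hu₀.1 i) (Ne.symm hi)) u hu)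
    have hlt : |T (u - u₀) i| < ρ * b i := by
      refine hbox ρ _ (hbox' u hne) i ?_
      rw [hTinv]
      simp [hu, show u₀ i = 0 from hi]
    have hTline : ∀ s : ℝ, T (u + s • vvec r i - u₀) = T (u - u₀) - s • Pi.single i 1 := by
      intro s
      have : u + s • vvec r i - u₀ = (u - u₀) + s • vvec r i := by abel
      rw [this, show T (u - u₀ + s • vvec r i) = T (u - u₀) + s • T (vvec r i) by
        simp [hT, mulVec_add, mulVec_smul], hTv i hi, smul_neg, ← sub_eq_add_neg]
    have hone : ∀ x : ℝ, |x| < ρ * b i → β i x = 1 := fun x hx =>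
      (β i).one_of_mem_closedBall (by simpa [β] using hx.le)
    have hev : ∀ᶠ s : ℝ in 𝓝 0, χ (u + s • vvec r i) = χ u := by
      have hc : Continuous fun s : ℝ => |T (u - u₀) i - s| := by fun_prop
      have hnear : ∀ᶠ s : ℝ in 𝓝 0, |T (u - u₀) i - s| < ρ * b i :=
        hc.continuousAt.eventually (gt_mem_nhds (by simpa using hlt))
      filter_upwards [hnear] with s hs
      refine prod_congr rfl fun j _ => ?_
      rw [hTline]
      by_cases hj : j = i
      · subst hj
        rw [hone _ hlt, hone]
        simpa using hs
      · simp [hj]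
    rw [hline, lineDeriv, EventuallyEq.deriv_eq (f := fun _ => χ u) hev, deriv_const]
  · have hall : ∀ j, ∀ᶠ u in 𝓝 u₀, β j (T (u - u₀) j) = 1 := by
      intro j
      have hc : Continuous fun u => T (u - u₀) j :=
        (continuous_apply j).comp (hTcont.continuous.comp (continuous_id.sub continuous_const))
      have h0 : T (u₀ - u₀) j = 0 := by simp [hT]
      have hβ : ∀ᶠ x in 𝓝 (T (u₀ - u₀) j), β j x = 1 := by
        rw [h0]
        exact (β j).eventuallyEq_one
      exact hc.continuousAt.eventually hβ
    filter_upwards [eventually_all.2 hall] with u hu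
    exact prod_eq_one fun j _ => hu j

/-- A cutoff function in the domain `D_V`, equal to one on `s` to first order and vanishing on the
faces `u i = 0`, `i ∈ A`. -/
def IsCutoff {V : Type*} [Fintype V] [DecidableEq V] (r : V → V → ℝ) (A : Finset V)
    (s : Set (V → ℝ)) (χ : (V → ℝ) → ℝ) : Prop :=
  ContDiff ℝ 1 χ ∧ (∀ i u, u i = 0 → fderiv ℝ χ u (vvec r i) = 0) ∧
    (∀ i ∈ A, ∀ u : V → ℝ, u i = 0 → χ u = 0) ∧ ∀ u ∈ s, χ u = 1 ∧ fderiv ℝ χ u = 0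

theorem IsCutoff.union {V : Type*} [Fintype V] [DecidableEq V] {r : V → V → ℝ} {A : Finset V}
    {s t : Set (V → ℝ)} {χ ψ : (V → ℝ) → ℝ} (hχ : IsCutoff r A s χ) (hψ : IsCutoff r A t ψ) :
    IsCutoff r A (s ∪ t) (χ + ψ - χ * ψ) := by
  obtain ⟨hχ1, hχ2, hχ3, hχ4⟩ := hχ
  obtain ⟨hψ1, hψ2, hψ3, hψ4⟩ := hψ
  have hd : ∀ u, fderiv ℝ (χ + ψ - χ * ψ) u =
      fderiv ℝ χ u + fderiv ℝ ψ u - (χ u • fderiv ℝ ψ u + ψ u • fderiv ℝ χ u) := fun u =>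
    have h1 := (hχ1.differentiable one_ne_zero u).hasFDerivAt
    have h2 := (hψ1.differentiable one_ne_zero u).hasFDerivAt
    ((h1.add h2).sub (h1.mul h2)).fderiv
  refine ⟨(hχ1.add hψ1).sub (hχ1.mul hψ1), fun i u hu => ?_, fun i hi u hu => ?_, ?_⟩
  · simp [hd, hχ2 i u hu, hψ2 i u hu]
  · simp [hχ3 i hi u hu, hψ3 i hi u hu]
  · rintro u (hu | hu)
    · simp [hd, hχ4 u hu]
    · simp [hd, hψ4 u hu]

theorem exists_isCutoff {V : Type*} [Fintype V] [DecidableEq V] {r : V → V → ℝ}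
    (hr : ∀ i j, 0 ≤ r i j) (hirr : IrreducibleRates r) {A : Finset V} {K : Set (V → ℝ)}
    (hK : IsCompact K) (hKs : K ⊆ stdSimplex ℝ V) (hKA : ∀ u ∈ K, ∀ i ∈ A, 0 < u i) :
    ∃ χ, IsCutoff r A K χ := by
  refine hK.induction_on (p := fun s => ∃ χ, IsCutoff r A s χ) ?_ ?_ ?_ ?_
  · refine ⟨0, contDiff_const, fun i u _ => ?_, fun _ _ _ _ => rfl, fun u hu => hu.elim⟩
    simp
  · rintro s t hst ⟨χ, h1, h2, h3, h4⟩
    exact ⟨χ, h1, h2, h3, fun u hu => h4 u (hst hu)⟩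
  · rintro s t ⟨χ, hχ⟩ ⟨ψ, hψ⟩
    exact ⟨_, hχ.union hψ⟩
  · intro u₀ hu₀
    obtain ⟨χ, h1, h2, h3, h4⟩ := exists_bump hr hirr (hKs hu₀)
    refine ⟨_, nhdsWithin_le_nhds h4.eventually_nhds, χ, h1, h2,
      fun i hi => h3 i (hKA u₀ hu₀ i hi), fun u hu => ⟨hu.self_of_nhds, ?_⟩⟩
    rw [EventuallyEq.fderiv_eq (f := fun _ => (1 : ℝ)) hu]
    simp

/-- extension lemma. For nonempty `A`, `B = V∖A`, `h ∈ D_B` and `ε > 0`,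
there is `f ∈ D_V` agreeing with `h` (together with `λ(f) = λ(h)`) on
`{u ∈ Σ : u(i) ≥ ε ∀ i ∈ A}`. -/
theorem extension_lemma (V : Type*) [Fintype V] [DecidableEq V] [Nonempty V]
    (r : V → V → ℝ) (hr_nonneg : ∀ i j, 0 ≤ r i j) (hr_diag : ∀ i, r i i = 0)
    (hr_irr : IrreducibleRates r)
    (A : Finset V) (hA : A.Nonempty)
    (h : (V → ℝ) → ℝ) (hh : MemD r Aᶜ h)
    (ε : ℝ) (hε : 0 < ε) :
    ∃ f : (V → ℝ) → ℝ, MemD r Finset.univ f ∧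
      ∀ u ∈ stdSimplex ℝ V, (∀ i ∈ A, ε ≤ u i) →
        f u = h u ∧ fderiv ℝ f u (lamV r) = fderiv ℝ h u (lamV r) := by
  set K : Set (V → ℝ) := stdSimplex ℝ V ∩ {u | ∀ i ∈ A, ε ≤ u i}
  have hK : IsCompact K := by
    refine (isCompact_stdSimplex ℝ V).inter_right ?_
    simp only [Set.ofPred_forall]
    exact isClosed_iInter fun i => isClosed_iInter fun _ =>
      isClosed_le continuous_const (continuous_apply i)
  obtain ⟨χ, hχ1, hχ2, hχ3, hχ4⟩ := exists_isCutoff hr_nonneg hr_irr (A := A) hK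
    Set.inter_subset_left fun u hu i hi => hε.trans_le (hu.2 i hi)
  obtain ⟨⟨U, hU, hsU, hhU⟩, hhB⟩ := hh
  have hd : ∀ u ∈ stdSimplex ℝ V,
      fderiv ℝ (h * χ) u = h u • fderiv ℝ χ u + χ u • fderiv ℝ h u := fun u hu =>
    (((hhU.contDiffAt (hU.mem_nhds (hsU hu))).differentiableAt one_ne_zero).hasFDerivAt.mul
      (hχ1.differentiable one_ne_zero u).hasFDerivAt).fderiv
  refine ⟨h * χ, ⟨⟨U, hU, hsU, hhU.mul hχ1.contDiffOn⟩, fun i _ u hu hui => ?_⟩,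
    fun u hu huA => ?_⟩
  · by_cases hi : i ∈ A
    · simp [hd u hu, hχ2 i u hui, hχ3 i hi u hui]
    · simp [hd u hu, hχ2 i u hui, hhB i (mem_compl.2 hi) u hu hui]
  · obtain ⟨h1, h2⟩ := hχ4 u ⟨hu, huA⟩
    simp [hd u hu, h1, h2]
end

section
/- Suppose the continuous path ζ : [0,∞) → Σ satisfies condition (A). Let A ⊆ V be nonempty and 0 ≤ s₁ < s₂. If ζ_t(i) > 0 for every i ∈ A and every t ∈ [s₁,s₂], then for every i ∈ A and every t ∈ [s₁,s₂]: ∑_{k∈V} 1^A_i(k)·ζ_t(k) = ∑_{k∈V} 1^A_i(k)·ζ_{s₁}(k) + λ^A(i)·(t − s₁). -/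
open Finset

section ZRPLemmas

open Filter Topology Matrix

variable {V : Type*} [Fintype V]

/-- Minimum principle: a function that is nonnegative on a nonempty set `B` and superharmonic off
`B` is nonnegative. -/
lemma nonneg_of_superharmonic_off {r : V → V → ℝ} (hr : ∀ i j, 0 ≤ r i j)
    (hirr : IrreducibleRates r) {B : Finset V} (hB : B.Nonempty) {g : V → ℝ}
    (hgB : ∀ i ∈ B, 0 ≤ g i) (hg : ∀ i ∉ B, ∑ l, r i l * (g l - g i) ≤ 0) (i : V) :
    0 ≤ g i := by
  obtain ⟨b, hb⟩ := hB
  obtain ⟨a, -, ha⟩ := Finset.exists_min_image Finset.univ g ⟨b, Finset.mem_univ b⟩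
  refine le_trans ?_ (ha i (Finset.mem_univ i))
  by_contra! hneg
  have hab : a ≠ b := by
    rintro rfl
    exact absurd (hgB a hb) (not_le.2 hneg)
  obtain ⟨m, k, hk0, hkm, hk⟩ := hirr a b hab
  have key : ∀ l, l ≤ m → g (k l) = g a := by
    intro l
    induction l with
    | zero => intro _; rw [hk0]
    | succ l ih =>
      intro hl
      have hl' := ih (by omega)
      have hnB : k l ∉ B := fun h => by
        have := hgB _ h
        linarith
      have hterm : ∀ j ∈ Finset.univ, 0 ≤ r (k l) j * (g j - g (k l)) := fun j hj =>
        mul_nonneg (hr _ _) (by have := ha j hj; linarith)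
      have hz := (Finset.sum_eq_zero_iff_of_nonneg hterm).1
        (le_antisymm (hg _ hnB) (Finset.sum_nonneg hterm)) (k (l + 1)) (Finset.mem_univ _)
      rcases mul_eq_zero.1 hz with h | h
      · exact absurd h (hk l (by omega)).ne'
      · linarith
  have := hgB b hb
  rw [← hkm, key m le_rfl] at this
  linarith

lemma dotProduct_lamV (r : V → V → ℝ) (w : V → ℝ) :
    ∑ k, w k * lamV r k = ∑ i, ∑ l, r i l * (w l - w i) := by
  simp only [lamV, Finset.mul_sum, mul_sub, Finset.sum_sub_distrib]
  congr 1
  · rw [Finset.sum_comm]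
    simp only [mul_comm]
  · simp only [mul_comm]

variable [DecidableEq V]

/-- The matrix acting as the identity at the points of `B` and as `-L` at the other points. -/
def dirichletMatrix (r : V → V → ℝ) (B : Finset V) : Matrix V V ℝ :=
  fun m k => (if m = k then (if k ∈ B then 1 else ∑ l, r k l) else 0) -
    (if m ∈ B then 0 else r m k)

lemma dirichletMatrix_mulVec (r : V → V → ℝ) (B : Finset V) (g : V → ℝ) (m : V) :
    (dirichletMatrix r B *ᵥ g) m = if m ∈ B then g m else -∑ l, r m l * (g l - g m) := by
  by_cases hm : m ∈ B <;>
    simp [dirichletMatrix, Matrix.mulVec, dotProduct, hm, sub_mul, mul_sub, Finset.sum_sub_distrib,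
      Finset.sum_mul]

lemma vecMul_dirichletMatrix (r : V → V → ℝ) (B : Finset V) (x : V → ℝ) (k : V) :
    (x ᵥ* dirichletMatrix r B) k =
      (if k ∈ B then 1 else ∑ l, r k l) * x k - ∑ m ∈ Bᶜ, x m * r m k := by
  have h : ∑ m ∈ Bᶜ, x m * r m k = ∑ m, x m * (if m ∈ B then 0 else r m k) := by
    rw [← Finset.sum_add_sum_compl B (fun m => x m * (if m ∈ B then 0 else r m k)),
      Finset.sum_eq_zero (s := B) fun m hm => by simp [hm], zero_add]
    exact Finset.sum_congr rfl fun m hm => by simp [Finset.mem_compl.1 hm]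
  simp only [Matrix.vecMul, dotProduct, dirichletMatrix, mul_sub, Finset.sum_sub_distrib, ← h]
  simp [mul_comm]

/-- The Dirichlet matrix of a nonempty set has a nonnegative inverse (the Green function). -/
lemma exists_nonneg_inverse_dirichletMatrix {r : V → V → ℝ} (hr : ∀ i j, 0 ≤ r i j)
    (hirr : IrreducibleRates r) {B : Finset V} (hB : B.Nonempty) :
    ∃ G : Matrix V V ℝ, dirichletMatrix r B * G = 1 ∧ G * dirichletMatrix r B = 1 ∧
      ∀ i j, 0 ≤ G i j := by
  have hpos : ∀ g : V → ℝ, (∀ m, 0 ≤ (dirichletMatrix r B *ᵥ g) m) → ∀ m, 0 ≤ g m := by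
    intro g hg
    refine nonneg_of_superharmonic_off hr hirr hB (fun i hi => ?_) (fun i hi => ?_)
    · simpa [dirichletMatrix_mulVec, hi] using hg i
    · have := hg i
      rw [dirichletMatrix_mulVec, if_neg hi] at this
      linarith
  have hinj : Function.Injective (dirichletMatrix r B).mulVec := by
    intro g g' h
    have h' : dirichletMatrix r B *ᵥ g = dirichletMatrix r B *ᵥ g' := h
    ext m
    have h1 := hpos (g - g') (fun m => by simp [Matrix.mulVec_sub, h']) m
    have h2 := hpos (g' - g) (fun m => by simp [Matrix.mulVec_sub, h']) m
    simp only [Pi.sub_apply] at h1 h2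
    linarith
  have hdet := (Matrix.isUnit_iff_isUnit_det _).1 (Matrix.mulVec_injective_iff_isUnit.1 hinj)
  have hKG := Matrix.mul_nonsing_inv _ hdet
  refine ⟨(dirichletMatrix r B)⁻¹, hKG, Matrix.nonsing_inv_mul _ hdet, fun i j => ?_⟩
  refine hpos (fun i => (dirichletMatrix r B)⁻¹ i j) (fun m => ?_) i
  have : (dirichletMatrix r B *ᵥ fun i => (dirichletMatrix r B)⁻¹ i j) m =
      (1 : Matrix V V ℝ) m j := by
    rw [← hKG]
    rfl
  rw [this, Matrix.one_apply]
  split_ifs <;> norm_num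

lemma vvec_eq_neg_dirichletMatrix (r : V → V → ℝ) {B : Finset V} {i : V} (hi : i ∉ B) :
    vvec r i = -(dirichletMatrix r B) i := by
  ext l
  by_cases h : l = i
  · subst h
    simp [vvec, dirichletMatrix, hi, mul_sub, Finset.sum_sub_distrib]
  · simp [vvec, dirichletMatrix, hi, h, Ne.symm h]

lemma dotProduct_vvec (r : V → V → ℝ) (w : V → ℝ) (i : V) :
    ∑ k, w k * vvec r i k = ∑ l, r i l * (w l - w i) := by
  have h := dirichletMatrix_mulVec r ∅ w i
  have hv := vvec_eq_neg_dirichletMatrix r (Finset.notMem_empty i)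
  simp only [Finset.notMem_empty, if_false] at h
  rw [← neg_eq_iff_eq_neg] at h
  rw [← h, hv]
  simp [Matrix.mulVec, dotProduct, mul_comm]

lemma exists_contDiff_step {a b : ℝ} (hab : a < b) :
    ∃ ψ : ℝ → ℝ, ContDiff ℝ 1 ψ ∧ (∀ x ≤ a, ψ x = 1) ∧ ∀ x, b ≤ x → ψ x = 0 := by
  have hba : 0 < b - a := sub_pos.2 hab
  refine ⟨fun x => Real.smoothTransition ((b - x) / (b - a)), ?_, fun x hx => ?_, fun x hx => ?_⟩
  · exact Real.smoothTransition.contDiff.comp (by fun_prop)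
  · exact Real.smoothTransition.one_of_one_le ((one_le_div hba).2 (by linarith))
  · exact Real.smoothTransition.zero_of_nonpos
      (div_nonpos_of_nonpos_of_nonneg (by linarith) hba.le)

/-- A point of the simplex with support `B` has a cutoff function compatible with the boundary
conditions defining `D_V`: it vanishes near the faces `u i = 0` with `i ∈ B`, and is locally
constant in the direction `v_i` on the faces with `i ∉ B`. -/
lemma exists_cutoff {r : V → V → ℝ} (hr : ∀ i j, 0 ≤ r i j) (hdiag : ∀ i, r i i = 0)
    (hirr : IrreducibleRates r) {u₀ : V → ℝ} {B : Finset V} (hB : B.Nonempty)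
    (hpos : ∀ i ∈ B, 0 < u₀ i) (hzero : ∀ i ∉ B, u₀ i = 0) :
    ∃ φ : (V → ℝ) → ℝ, ContDiff ℝ 1 φ ∧ (∀ᶠ u in 𝓝 u₀, φ u = 1) ∧
      (∀ i ∈ B, ∀ u : V → ℝ, u i = 0 → ∀ᶠ u' in 𝓝 u, φ u' = 0) ∧
      (∀ i ∉ B, ∀ u : V → ℝ, u i = 0 →
        ∀ᶠ s in 𝓝 (0 : ℝ), φ (u + s • vvec r i) = φ u) := by
  obtain ⟨G, hKG, hGK, hG⟩ := exists_nonneg_inverse_dirichletMatrix hr hirr hB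
  have hbal : ∀ (u : V → ℝ) k, u k = (if k ∈ B then 1 else ∑ l, r k l) * (u ᵥ* G) k -
      ∑ m ∈ Bᶜ, (u ᵥ* G) m * r m k := by
    intro u k
    rw [← vecMul_dirichletMatrix, Matrix.vecMul_vecMul, hGK, Matrix.vecMul_one]
  have hcont : ∀ k, Continuous fun u : V → ℝ => (u ᵥ* G) k := fun k => by
    simp only [Matrix.vecMul, dotProduct]
    fun_prop
  -- the occupation measure started from the indicator of the complement of `B`
  obtain ⟨p, hp0, hp⟩ : ∃ p : V → ℝ, (∀ k, 0 ≤ p k) ∧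
      ∀ k ∉ B, (∑ l, r k l) * p k - ∑ m ∈ Bᶜ, p m * r m k = 1 := by
    refine ⟨(fun k => if k ∈ B then 0 else 1) ᵥ* G, fun k => ?_, fun k hk => ?_⟩
    · refine Finset.sum_nonneg fun m _ => mul_nonneg ?_ (hG m k)
      dsimp only
      split_ifs <;> norm_num
    · have := hbal (fun k => if k ∈ B then 0 else 1) k
      simp only [hk, if_false] at this
      exact this.symm
  have hsum0 : ∀ k, 0 ≤ ∑ m ∈ Bᶜ, p m * r m k := fun k =>
    Finset.sum_nonneg fun m _ => mul_nonneg (hp0 m) (hr m k)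
  have hR : ∀ k ∉ B, 0 < ∑ l, r k l := fun k hk => by
    rcases (Finset.sum_nonneg fun l _ => hr k l : 0 ≤ ∑ l, r k l).lt_or_eq with h | h
    · exact h
    · have := hp k hk
      rw [← h] at this
      linarith [hsum0 k]
  obtain ⟨δ, hδB, hδ⟩ : ∃ δ : ℝ, (∀ k, k ∈ B → δ * ∑ m ∈ Bᶜ, p m * r m k < u₀ k / 3) ∧ 0 < δ := by
    have h1 : ∀ᶠ δ in 𝓝[>] (0 : ℝ), ∀ k, k ∈ B → δ * ∑ m ∈ Bᶜ, p m * r m k < u₀ k / 3 := by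
      rw [eventually_all]
      intro k
      by_cases hk : k ∈ B
      · have ht : Tendsto (fun δ : ℝ => δ * ∑ m ∈ Bᶜ, p m * r m k) (𝓝[>] 0) (𝓝 0) := by
          have : Tendsto (fun δ : ℝ => δ * ∑ m ∈ Bᶜ, p m * r m k) (𝓝 0) (𝓝 (0 * _)) :=
            tendsto_id.mul_const _
          rw [zero_mul] at this
          exact this.mono_left nhdsWithin_le_nhds
        have h3 : 0 < u₀ k / 3 := div_pos (hpos k hk) (by norm_num)
        filter_upwards [ht.eventually_lt_const h3] with δ h _ using h
      · simp [hk]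
    exact (h1.and self_mem_nhdsWithin).exists
  -- one-dimensional cutoffs
  have hψ : ∀ k, ∃ ψ : ℝ → ℝ, ContDiff ℝ 1 ψ ∧
      (k ∈ B → (∀ x, u₀ k * (2 / 3) ≤ x → ψ x = 1) ∧ ∀ x ≤ u₀ k / 3, ψ x = 0) ∧
      (k ∉ B → (∀ x ≤ δ * (p k - 1 / (2 * ∑ l, r k l)), ψ x = 1) ∧
        ∀ x, δ * p k ≤ x → ψ x = 0) := by
    intro k
    by_cases hk : k ∈ B
    · have := hpos k hk
      obtain ⟨ψ, h1, h2, h3⟩ := exists_contDiff_step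
        (show -(u₀ k * (2 / 3)) < -(u₀ k / 3) by linarith)
      exact ⟨fun x => ψ (-x), h1.comp contDiff_neg, fun _ => ⟨fun x hx => h2 _ (neg_le_neg hx),
        fun x hx => h3 _ (neg_le_neg hx)⟩, fun h => absurd hk h⟩
    · have := hR k hk
      obtain ⟨ψ, h1, h2, h3⟩ := exists_contDiff_step
        (show δ * (p k - 1 / (2 * ∑ l, r k l)) < δ * p k from
          mul_lt_mul_of_pos_left (sub_lt_self _ (by positivity)) hδ)
      exact ⟨ψ, h1, fun h => absurd h hk, fun _ => ⟨h2, h3⟩⟩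
  choose ψ hψc hψB hψC using hψ
  refine ⟨fun u => ∏ k, ψ k ((u ᵥ* G) k), ?_, ?_, ?_, ?_⟩
  · refine contDiff_prod fun k _ => (hψc k).comp ?_
    simp only [Matrix.vecMul, dotProduct]
    fun_prop
  · have hx₀ : u₀ ᵥ* G = u₀ := by
      have h : u₀ ᵥ* dirichletMatrix r B = u₀ := by
        ext k
        have hs : ∑ m ∈ Bᶜ, u₀ m * r m k = 0 := Finset.sum_eq_zero fun m hm => by
          rw [hzero m (Finset.mem_compl.1 hm), zero_mul]
        rw [vecMul_dirichletMatrix, hs]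
        by_cases hk : k ∈ B
        · simp [hk]
        · simp [hk, hzero k hk]
      conv_lhs => rw [← h, Matrix.vecMul_vecMul, hKG, Matrix.vecMul_one]
    have hall : ∀ᶠ u in 𝓝 u₀, ∀ k, ψ k ((u ᵥ* G) k) = 1 := by
      rw [eventually_all]
      intro k
      have ht : Tendsto (fun u : V → ℝ => (u ᵥ* G) k) (𝓝 u₀) (𝓝 (u₀ k)) := by
        have := (hcont k).tendsto u₀
        rwa [hx₀] at this
      by_cases hk : k ∈ B
      · have := hpos k hk
        filter_upwards [ht.eventually_const_lt (show u₀ k * (2 / 3) < u₀ k by linarith)] with u hu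
        exact (hψB k hk).1 _ hu.le
      · have hRk := hR k hk
        have : 0 < δ * (p k - 1 / (2 * ∑ l, r k l)) := by
          refine mul_pos hδ (sub_pos.2 ?_)
          rw [div_lt_iff₀ (by positivity)]
          linarith [hp k hk, hsum0 k]
        rw [hzero k hk] at ht
        filter_upwards [ht.eventually_lt_const this] with u hu
        exact (hψC k hk).1 _ hu.le
    filter_upwards [hall] with u hu
    exact Finset.prod_eq_one fun k _ => hu k
  · intro i hi u hu
    by_cases h : ∃ m ∉ B, δ * p m < (u ᵥ* G) m
    · obtain ⟨m, hm, hlt⟩ := h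
      filter_upwards [(hcont m).continuousAt.eventually_const_lt hlt] with u' hu'
      exact Finset.prod_eq_zero (Finset.mem_univ m) ((hψC m hm).2 _ hu'.le)
    · push Not at h
      have h1 := hbal u i
      rw [hu, if_pos hi, one_mul] at h1
      have h2 : ∑ m ∈ Bᶜ, (u ᵥ* G) m * r m i ≤ δ * ∑ m ∈ Bᶜ, p m * r m i := by
        rw [Finset.mul_sum]
        refine Finset.sum_le_sum fun m hm => ?_
        rw [← mul_assoc]
        exact mul_le_mul_of_nonneg_right (h m (Finset.mem_compl.1 hm)) (hr m i)
      have hlt : (u ᵥ* G) i < u₀ i / 3 := by linarith [hδB i hi]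
      filter_upwards [(hcont i).continuousAt.eventually_lt_const hlt] with u' hu'
      exact Finset.prod_eq_zero (Finset.mem_univ i) ((hψB i hi).2 _ hu'.le)
  · intro i hi u hu
    have hline : ∀ (s : ℝ) m, ((u + s • vvec r i) ᵥ* G) m =
        (u ᵥ* G) m - s * (if i = m then 1 else 0) := by
      intro s m
      have : vvec r i ᵥ* G = -((1 : Matrix V V ℝ) i) := by
        rw [vvec_eq_neg_dirichletMatrix r hi, Matrix.neg_vecMul, ← hKG]
        rfl
      rw [Matrix.add_vecMul, Matrix.smul_vecMul, this]
      simp [Matrix.one_apply, sub_eq_add_neg]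
    by_cases h : ∃ m ∉ B, m ≠ i ∧ δ * p m ≤ (u ᵥ* G) m
    · obtain ⟨m, hm, hmi, hle⟩ := h
      refine Eventually.of_forall fun s => ?_
      have h0 := (hψC m hm).2 _ hle
      simp only
      rw [Finset.prod_eq_zero (Finset.mem_univ m), Finset.prod_eq_zero (Finset.mem_univ m) h0]
      rw [hline, if_neg hmi.symm, mul_zero, sub_zero, h0]
    · push Not at h
      have hRi := hR i hi
      have h1 := hbal u i
      rw [hu, if_neg hi] at h1
      have h2 : ∑ m ∈ Bᶜ, (u ᵥ* G) m * r m i ≤ δ * ∑ m ∈ Bᶜ, p m * r m i := by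
        rw [Finset.mul_sum]
        refine Finset.sum_le_sum fun m hm => ?_
        by_cases hmi : m = i
        · simp [hmi, hdiag]
        · rw [← mul_assoc]
          exact mul_le_mul_of_nonneg_right (h m (Finset.mem_compl.1 hm) hmi).le (hr m i)
      have h3 : ∑ m ∈ Bᶜ, p m * r m i = (∑ l, r i l) * p i - 1 := by linarith [hp i hi]
      rw [h3] at h2
      have hlt : (u ᵥ* G) i < δ * (p i - 1 / (2 * ∑ l, r i l)) := by
        refine lt_of_mul_lt_mul_left (a := ∑ l, r i l) ?_ hRi.le
        have : (∑ l, r i l) * (δ * (p i - 1 / (2 * ∑ l, r i l))) =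
            δ * ((∑ l, r i l) * p i - 1 / 2) := by
          field_simp
        rw [this]
        linarith
      have hlt0 : (u ᵥ* G) i - 0 * (if i = i then 1 else 0) <
          δ * (p i - 1 / (2 * ∑ l, r i l)) := by
        rwa [zero_mul, sub_zero]
      have hc : ContinuousAt (fun s : ℝ => (u ᵥ* G) i - s * (if i = i then 1 else 0)) 0 := by
        fun_prop
      filter_upwards [hc.eventually_lt_const hlt0] with s hs
      refine Finset.prod_congr rfl fun m _ => ?_
      rw [hline]
      by_cases hmi : i = m
      · subst hmi
        rw [(hψC i hi).1 _ hs.le, (hψC i hi).1 _ hlt.le]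
      · rw [if_neg hmi, mul_zero, sub_zero]

/-- If `w` is harmonic off `A` and the coordinates in `A` are positive at time `t₀`, then
`⟨w, ζ⟩` has derivative `⟨w, λ⟩` at `t₀`, from within the nonnegative times. -/
lemma hasDerivWithinAt_of_condA {r : V → V → ℝ} (hr : ∀ i j, 0 ≤ r i j)
    (hdiag : ∀ i, r i i = 0) (hirr : IrreducibleRates r) {ζ : ℝ → V → ℝ} (hζ : IsPath ζ)
    (hζA : CondA r ζ) {A : Finset V} (hA : A.Nonempty) {w : V → ℝ}
    (hw : ∀ i ∉ A, ∑ l, r i l * (w l - w i) = 0) {t₀ : ℝ} (ht₀ : 0 ≤ t₀)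
    (hpos : ∀ i ∈ A, 0 < ζ t₀ i) :
    HasDerivWithinAt (fun t => ∑ k, w k * ζ t k) (∑ k, w k * lamV r k) (Set.Ici 0) t₀ := by
  set B : Finset V := Finset.univ.filter fun i => 0 < ζ t₀ i with hBdef
  have hAB : A ⊆ B := fun i hi => by simpa [hBdef] using hpos i hi
  obtain ⟨φ, hφ, hφ1, hφB, hφC⟩ := exists_cutoff (u₀ := ζ t₀) hr hdiag hirr (hA.mono hAB)
    (fun i hi => by simpa [hBdef] using hi)
    (fun i hi => le_antisymm (by simpa [hBdef] using hi) ((hζ.2 t₀ ht₀).1 i))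
  set H : (V → ℝ) →L[ℝ] ℝ := ∑ k, w k • ContinuousLinearMap.proj (R := ℝ) (φ := fun _ => ℝ) k
    with hHdef
  have hH : ∀ u, H u = ∑ k, w k * u k := fun u => by
    simp [hHdef]
  have hf : ContDiff ℝ 1 (fun u => H u * φ u) := H.contDiff.mul hφ
  have hmem : MemD r Finset.univ (fun u => H u * φ u) := by
    refine ⟨⟨Set.univ, isOpen_univ, Set.subset_univ _, hf.contDiffOn⟩, fun i _ u _ hui => ?_⟩
    rw [← (hf.differentiable one_ne_zero u).lineDeriv_eq_fderiv, lineDeriv]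
    by_cases hi : i ∈ B
    · have hc : Tendsto (fun s : ℝ => u + s • vvec r i) (𝓝 0) (𝓝 u) := by
        have : Continuous (fun s : ℝ => u + s • vvec r i) := by fun_prop
        simpa using this.tendsto 0
      have : (fun s : ℝ => H (u + s • vvec r i) * φ (u + s • vvec r i)) =ᶠ[𝓝 0] fun _ => 0 := by
        filter_upwards [hc.eventually (hφB i hi u hui)] with s hs
        rw [hs, mul_zero]
      rw [this.deriv_eq, deriv_const]
    · have : (fun s : ℝ => H (u + s • vvec r i) * φ (u + s • vvec r i)) =ᶠ[𝓝 0]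
          fun _ => H u * φ u := by
        filter_upwards [hφC i hi u hui] with s hs
        rw [hs, map_add, map_smul, hH (vvec r i), dotProduct_vvec, hw i fun h => hi (hAB h)]
        simp
      rw [this.deriv_eq, deriv_const]
  have hfH : (fun u => H u * φ u) =ᶠ[𝓝 (ζ t₀)] H := by
    filter_upwards [hφ1] with u hu
    rw [hu, mul_one]
  have hcont : Continuous fun s => ζ (max s 0) :=
    hζ.1.comp_continuous (by fun_prop) fun s => le_max_right s 0
  have hg : Continuous fun s => fderiv ℝ (fun u => H u * φ u) (ζ (max s 0)) (lamV r) :=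
    ((hf.continuous_fderiv one_ne_zero).comp hcont).clm_apply continuous_const
  have hder := (hg.integral_hasStrictDerivAt 0 t₀).hasDerivAt.hasDerivWithinAt (s := Set.Ici 0)
  rw [max_eq_left ht₀, hfH.fderiv_eq, H.fderiv, hH] at hder
  have hev : ∀ᶠ t in 𝓝[Set.Ici 0] t₀, φ (ζ t) = 1 :=
    (hζ.1 t₀ ht₀).eventually hφ1
  refine (hder.const_add (H (ζ 0) * φ (ζ 0))).congr_of_eventuallyEq_of_mem ?_ ht₀
  filter_upwards [hev, self_mem_nhdsWithin] with t ht ht0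
  have h := hζA _ hmem t ht0
  simp only [ht, mul_one] at h
  rw [← hH, h]
  congr 1
  refine intervalIntegral.integral_congr fun s hs => ?_
  rw [Set.uIcc_of_le ht0] at hs
  simp only [max_eq_left hs.1]

/-- The vectors `1^A_j`, `j ∈ A`, sum up to `1`. -/
lemma IsHarmFamily.sum_eq_one {r : V → V → ℝ} (hr : ∀ i j, 0 ≤ r i j)
    (hirr : IrreducibleRates r) {ind : Finset V → V → V → ℝ} (hind : IsHarmFamily r ind)
    {A : Finset V} (hA : A.Nonempty) (k : V) : ∑ j ∈ A, ind A j k = 1 := by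
  have hb : ∀ i ∈ A, ∑ j ∈ A, ind A j i = 1 := fun i hi => by
    rw [Finset.sum_congr rfl fun j hj => (hind A j hj).1 i hi]
    simp [hi]
  have hh : ∀ i ∉ A, ∑ l, r i l * (∑ j ∈ A, ind A j l - ∑ j ∈ A, ind A j i) = 0 := fun i hi => by
    simp only [← Finset.sum_sub_distrib, Finset.mul_sum]
    rw [Finset.sum_comm]
    exact Finset.sum_eq_zero fun j hj => (hind A j hj).2 i hi
  have h1 := nonneg_of_superharmonic_off hr hirr hA (g := fun k => ∑ j ∈ A, ind A j k - 1)
    (fun i hi => by simp [hb i hi]) (fun i hi => by simp [hh i hi]) k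
  have h2 := nonneg_of_superharmonic_off hr hirr hA (g := fun k => 1 - ∑ j ∈ A, ind A j k)
    (fun i hi => by simp [hb i hi])
    (fun i hi => by
      have := hh i hi
      rw [← neg_eq_zero, ← Finset.sum_neg_distrib] at this
      refine (Eq.trans (Finset.sum_congr rfl fun l _ => ?_) this).le
      ring) k
  linarith

lemma IsHarmFamily.generator_eq_traceRate {r : V → V → ℝ} {ind : Finset V → V → V → ℝ}
    (hind : IsHarmFamily r ind) {A : Finset V} {i j : V} (hi : i ∈ A) (hj : j ∈ A) (hij : j ≠ i) :
    ∑ l, r j l * (ind A i l - ind A i j) = traceRate r ind A j i := by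
  rw [(hind A i hi).1 j hj, if_neg hij, traceRate, if_neg hij, ← Finset.sum_add_sum_compl A]
  simp only [sub_zero]
  congr 1
  rw [Finset.sum_congr rfl fun l hl => by rw [(hind A i hi).1 l hl]]
  simp [hi]

lemma dotProduct_ind_lamV {r : V → V → ℝ} (hr : ∀ i j, 0 ≤ r i j)
    (hirr : IrreducibleRates r) {ind : Finset V → V → V → ℝ} (hind : IsHarmFamily r ind)
    {A : Finset V} {i : V} (hi : i ∈ A) :
    ∑ k, ind A i k * lamV r k = lamA r ind A i := by
  have hgen : ∑ l, r i l * (ind A i l - ind A i i) = -∑ j ∈ A, traceRate r ind A i j := by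
    have h0 : ∑ j ∈ A, ∑ l, r i l * (ind A j l - ind A j i) = 0 := by
      rw [Finset.sum_comm]
      refine Finset.sum_eq_zero fun l _ => ?_
      rw [← Finset.mul_sum, Finset.sum_sub_distrib, hind.sum_eq_one hr hirr ⟨i, hi⟩,
        hind.sum_eq_one hr hirr ⟨i, hi⟩, sub_self, mul_zero]
    rw [← Finset.add_sum_erase _ _ hi] at h0 ⊢
    rw [Finset.sum_congr rfl fun j hj => hind.generator_eq_traceRate
      (Finset.mem_of_mem_erase hj) hi (Finset.ne_of_mem_erase hj).symm] at h0
    have : traceRate r ind A i i = 0 := by simp [traceRate]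
    linarith
  rw [dotProduct_lamV, ← Finset.sum_add_sum_compl A,
    Finset.sum_eq_zero (s := Aᶜ) fun k hk => (hind A i hi).2 k (Finset.mem_compl.1 hk), add_zero,
    lamA, Finset.sum_sub_distrib, ← Finset.add_sum_erase _ _ hi, hgen,
    Finset.sum_congr rfl fun j hj => hind.generator_eq_traceRate hi
      (Finset.mem_of_mem_erase hj) (Finset.ne_of_mem_erase hj),
    ← Finset.add_sum_erase _ (fun j => traceRate r ind A j i) hi]
  have : traceRate r ind A i i = 0 := by simp [traceRate]
  rw [this]
  ring

end ZRPLemmas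

/-- if `ζ` satisfies condition (A) and all coordinates in `A` stay positive on
`[s₁,s₂]`, then `⟨1^A_i, ζ_t⟩ = ⟨1^A_i, ζ_{s₁}⟩ + λ^A(i)(t − s₁)` on `[s₁,s₂]`. -/
theorem linear_evolution_on_A (V : Type*) [Fintype V] [DecidableEq V] [Nonempty V]
    (r : V → V → ℝ) (hr_nonneg : ∀ i j, 0 ≤ r i j) (hr_diag : ∀ i, r i i = 0)
    (hr_irr : IrreducibleRates r)
    (ind : Finset V → V → V → ℝ) (hind : IsHarmFamily r ind)
    (ζ : ℝ → V → ℝ) (hζ : IsPath ζ) (hζA : CondA r ζ)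
    (A : Finset V) (hA : A.Nonempty)
    (s₁ s₂ : ℝ) (hs₁ : 0 ≤ s₁) (hs : s₁ < s₂)
    (hpos : ∀ i ∈ A, ∀ t ∈ Set.Icc s₁ s₂, 0 < ζ t i) :
    ∀ i ∈ A, ∀ t ∈ Set.Icc s₁ s₂,
      ∑ k, ind A i k * ζ t k = ∑ k, ind A i k * ζ s₁ k + lamA r ind A i * (t - s₁) := by
  intro i hi
  have hder : ∀ t ∈ Set.Icc s₁ s₂, HasDerivWithinAt
      (fun t => ∑ k, ind A i k * ζ t k - lamA r ind A i * (t - s₁)) 0 (Set.Icc s₁ s₂) t := by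
    intro t ht
    have h := hasDerivWithinAt_of_condA hr_nonneg hr_diag hr_irr hζ hζA hA (hind A i hi).2
      (hs₁.trans ht.1) (fun j hj => hpos j hj t ht)
    rw [dotProduct_ind_lamV hr_nonneg hr_irr hind hi] at h
    have h' := (((hasDerivAt_id t).sub_const s₁).const_mul (lamA r ind A i)).hasDerivWithinAt
      (s := Set.Icc s₁ s₂)
    have h'' := (h.mono fun x (hx : x ∈ Set.Icc s₁ s₂) => hs₁.trans hx.1).sub h'
    rw [mul_one, sub_self] at h''
    exact h''
  intro t ht
  have hconst := constant_of_derivWithin_zero (fun t ht => (hder t ht).differentiableWithinAt)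
    (fun t ht => (hder t (Set.Ico_subset_Icc_self ht)).derivWithin
      (uniqueDiffOn_Icc hs t (Set.Ico_subset_Icc_self ht))) t ht
  simp only [sub_self, mul_zero, sub_zero] at hconst
  linarith
end
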